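/- arXiv:1707.05439 — 9 statements merged into one kernel-verified Lean document; each statement's English description precedes it below -/
import Mathlib

section
/- If G is a connected finite simple graph with girth at least 5 (no cycles of length 3 or 4) and G is not the 6-cycle C_6, then the distinguishing chromatic number of G satisfies χ_D(G) ≤ Δ(G) + 1, where Δ(G) is the maximum degree of G. -/
/-- A coloring `φ` of the vertices of `G` is a proper distinguishing coloring if adjacent
vertices get different colors and the only automorphism of `G` preserving all colors is
the identity. -/
def IsProperDistinguishingColoring {V α : Type*} (G : SimpleGraph V) (φ : V → α) : Prop :=
  (∀ u v, G.Adj u v → φ u ≠ φ v) ∧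
    ∀ f : G ≃g G, (∀ v, φ (f v) = φ v) → ∀ v, f v = v

lemma Finset.exists_injOn_of_card_le {α β : Type*} [Nonempty β] {s : Finset α} {t : Finset β}
    (h : s.card ≤ t.card) : ∃ f : α → β, (∀ a ∈ s, f a ∈ t) ∧ Set.InjOn f s := by
  obtain ⟨f, hf, hinj⟩ := s.finite_toSet.exists_injOn_of_encard_le (t := (t : Set β))
    (by simpa [Set.encard_coe_eq_coe_finsetCard] using h)
  exact ⟨f, fun a ha => hf ha, hinj⟩

lemma Finset.exists_notMem_of_card_lt {α : Type*} [Fintype α] {s : Finset α}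
    (h : s.card < Fintype.card α) : ∃ a, a ∉ s := by
  obtain ⟨a, -, ha⟩ := Finset.exists_mem_notMem_of_card_lt_card (t := Finset.univ) h
  exact ⟨a, ha⟩

namespace SimpleGraph

variable {V : Type*} {G : SimpleGraph V}

lemma not_adj_of_five_le_girth (hg : 5 ≤ G.girth) {a b c : V} (hab : G.Adj a b)
    (hbc : G.Adj b c) : ¬ G.Adj a c := by
  intro hac
  have hcyc : (Walk.cons hab (Walk.cons hbc (Walk.cons hac.symm Walk.nil))).IsCycle := by
    simp [Walk.isCycle_def, Walk.isTrail_def, hab.ne, hbc.ne, hac.ne, hab.ne.symm,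
      hac.ne.symm]
  have h := hcyc.girth_le_length
  simp only [Walk.length_cons, Walk.length_nil] at h
  omega

lemma eq_of_common_adj_of_five_le_girth (hg : 5 ≤ G.girth) {p q a b : V} (hpq : p ≠ q)
    (hpa : G.Adj p a) (hqa : G.Adj q a) (hpb : G.Adj p b) (hqb : G.Adj q b) : a = b := by
  by_contra hab
  have hcyc : (Walk.cons hpa (Walk.cons hqa.symm
      (Walk.cons hqb (Walk.cons hpb.symm Walk.nil)))).IsCycle := by
    simp [Walk.isCycle_def, Walk.isTrail_def, hpq, hab, hpa.ne, hpb.ne, hqb.ne,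
      hpa.ne.symm, hqa.ne.symm, hpb.ne.symm, Ne.symm hpq]
  have h := hcyc.girth_le_length
  simp only [Walk.length_cons, Walk.length_nil] at h
  omega

lemma Connected.mem_of_adj_closed (hconn : G.Connected) {S : Set V}
    (hS : ∀ u ∈ S, ∀ v, G.Adj u v → v ∈ S) {a : V} (ha : a ∈ S) (v : V) : v ∈ S := by
  obtain ⟨w⟩ := hconn a v
  induction w with
  | nil => exact ha
  | cons h _ ih => exact ih (hS _ ha _ h)

/-- A connected graph of maximum degree at most two that contains a hexagon is a hexagon. -/
lemma Connected.nonempty_iso_cycleGraph_six [Fintype V] [DecidableRel G.Adj]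
    (hconn : G.Connected) (hdeg : ∀ v, G.degree v ≤ 2) (g : Fin 6 → V)
    (hinj : Function.Injective g) (hadj : ∀ i, G.Adj (g i) (g (i + 1))) :
    Nonempty (G ≃g cycleGraph 6) := by
  classical
  have hnbr : ∀ i v, G.Adj (g i) v ↔ v = g (i + 1) ∨ v = g (i - 1) := by
    intro i v
    have hprev : G.Adj (g i) (g (i - 1)) := by
      have := hadj (i - 1)
      rw [sub_add_cancel] at this
      exact this.symm
    have hne : g (i + 1) ≠ g (i - 1) := fun h => by
      have key : ∀ j : Fin 6, j + 1 ≠ j - 1 := by decide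
      exact key i (hinj h)
    have hsub : ({g (i + 1), g (i - 1)} : Finset V) ⊆ G.neighborFinset (g i) := by
      intro w hw
      simp only [Finset.mem_insert, Finset.mem_singleton] at hw
      rw [mem_neighborFinset]
      rcases hw with rfl | rfl
      · exact hadj i
      · exact hprev
    have heq := Finset.eq_of_subset_of_card_le hsub (by
      rw [Finset.card_pair hne, card_neighborFinset_eq_degree]; exact hdeg _)
    rw [← mem_neighborFinset, ← heq]
    simp
  have hsurj : Function.Surjective g := by
    intro v
    refine hconn.mem_of_adj_closed (S := Set.range g) ?_ ⟨0, rfl⟩ v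
    rintro _ ⟨i, rfl⟩ w hw
    rcases (hnbr i w).1 hw with rfl | rfl
    exacts [⟨_, rfl⟩, ⟨_, rfl⟩]
  refine ⟨RelIso.symm ⟨Equiv.ofBijective g ⟨hinj, hsurj⟩, ?_⟩⟩
  intro i j
  change G.Adj (g i) (g j) ↔ _
  rw [hnbr, hinj.eq_iff, hinj.eq_iff, cycleGraph_adj]
  revert i j
  decide

/-- The partial coloring `ψ` of `T` extends the partial coloring `φ` of `S`, an automorphism that
fixes `S` and preserves `ψ` also fixes `T`, and a new vertex other than `u` has color `0` only if
it sees all other colors. -/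
structure IsGreedyExtension {n : ℕ} (G : SimpleGraph V) (u : V) (S T : Set V)
    (φ ψ : V → Fin (n + 1)) : Prop where
  subset : S ⊆ T
  agree : ∀ v ∈ S, ψ v = φ v
  proper : ∀ v ∈ T, ∀ w ∈ T, G.Adj v w → ψ v ≠ ψ w
  exists_adj : ∀ v ∈ T, ∃ w ∈ T, G.Adj v w
  zero : ∀ v ∈ T, v ∉ S → v ≠ u → ψ v = 0 → ∀ k ≠ 0, ∃ w ∈ T, G.Adj v w ∧ ψ w = k
  fixes : ∀ f : G ≃g G, (∀ v ∈ S, f v = v) → (∀ v ∈ T, f v ∈ T → ψ (f v) = ψ v) →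
    ∀ v ∈ T, f v = v

lemma IsGreedyExtension.trans {n : ℕ} {u : V} {S T U : Set V} {φ ψ χ : V → Fin (n + 1)}
    (h₁ : IsGreedyExtension G u S T φ ψ) (h₂ : IsGreedyExtension G u T U ψ χ) :
    IsGreedyExtension G u S U φ χ where
  subset := h₁.subset.trans h₂.subset
  agree v hv := (h₂.agree v (h₁.subset hv)).trans (h₁.agree v hv)
  proper := h₂.proper
  exists_adj := h₂.exists_adj
  zero v hv hvS hvu h0 k hk := by
    by_cases hvT : v ∈ T
    · rw [h₂.agree v hvT] at h0
      obtain ⟨w, hw, hvw, hwk⟩ := h₁.zero v hvT hvS hvu h0 k hk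
      exact ⟨w, h₂.subset hw, hvw, (h₂.agree w hw).trans hwk⟩
    · exact h₂.zero v hv hvT hvu h0 k hk
  fixes f hfS hf := by
    refine h₂.fixes f (h₁.fixes f hfS fun v hv hfv => ?_) hf
    rw [← h₂.agree v hv, ← h₂.agree _ hfv]
    exact hf v (h₂.subset hv) (h₂.subset hfv)

/-- One step of a greedy coloring: the uncolored neighbors of a colored vertex `p` are colored,
with the color of `z` prescribed. -/
lemma exists_extend_neighbors [Fintype V] [DecidableRel G.Adj] (hg : 5 ≤ G.girth)
    {n : ℕ} (hdeg : ∀ v, G.degree v ≤ n) {S : Set V} {φ : V → Fin (n + 1)}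
    (hφ : ∀ u ∈ S, ∀ v ∈ S, G.Adj u v → φ u ≠ φ v) (hS : ∀ p ∈ S, ∃ q ∈ S, G.Adj p q)
    {p : V} (hp : p ∈ S) (u z : V) (c : Fin (n + 1)) (hcu : z ∉ S → c = 0 → z = u)
    (hc : z ∉ S → ∀ w ∈ S, G.Adj z w → φ w ≠ c) :
    ∃ ψ : V → Fin (n + 1), IsGreedyExtension G u S (S ∪ G.neighborSet p) φ ψ ∧
      (z ∉ S → G.Adj p z → ψ z = c) ∧
      (∀ v ∉ S, G.Adj p v → v ≠ z → ψ v = 0 → ∀ k ≠ 0, ∃ w ∈ S, G.Adj v w ∧ φ w = k) := by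
  classical
  obtain ⟨q, hqS, hpq⟩ := hS p hp
  -- colors for the vertices with at least two colored neighbors
  have hb : ∀ v, ∃ k, (v ∉ S → ∀ w ∈ S, G.Adj v w → φ w ≠ k) ∧ (v ∉ S → v = z → k = c) ∧
      (v ∉ S → v ≠ z → k = 0 → ∀ k ≠ 0, ∃ w ∈ S, G.Adj v w ∧ φ w = k) := by
    intro v
    by_cases hvz : v = z
    · subst hvz
      exact ⟨c, hc, fun _ _ => rfl, fun _ h => absurd rfl h⟩
    by_cases hk : ∃ k ≠ 0, ∀ w ∈ S, G.Adj v w → φ w ≠ k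
    · obtain ⟨k, hk0, hk⟩ := hk
      exact ⟨k, fun _ => hk, fun _ h => absurd h hvz, fun _ _ h => absurd h hk0⟩
    · push Not at hk
      obtain ⟨k, hkn⟩ := Finset.exists_notMem_of_card_lt
        (s := (G.neighborFinset v).image φ) (by
          refine lt_of_le_of_lt Finset.card_image_le ?_
          rw [card_neighborFinset_eq_degree, Fintype.card_fin]
          exact Nat.lt_succ_of_le (hdeg v))
      refine ⟨k, fun _ w _ hvw hwk => hkn ?_, fun _ h => absurd h hvz, fun _ _ _ => hk⟩
      exact Finset.mem_image.2 ⟨w, by simpa using hvw, hwk⟩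
  choose b hbS hbz hb0 using hb
  -- colors for the vertices whose only colored neighbor is `p`
  have he : ∃ e : V → Fin (n + 1),
      (∀ u v, u ∉ S → v ∉ S → G.Adj p u → G.Adj p v → e u = e v → u = v) ∧
      (∀ v, v ∉ S → G.Adj p v → e v ≠ φ p) ∧ (z ∉ S → G.Adj p z → e z = c) ∧
      (∀ v, v ∉ S → G.Adj p v → v ≠ z → e v ≠ 0) := by
    obtain ⟨e, heC, heinj⟩ : ∃ e : V → Fin (n + 1),
        (∀ v ∈ (G.neighborFinset p).filter (· ∉ S), e v ∈ ({0, φ p} : Finset (Fin (n + 1)))ᶜ) ∧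
        Set.InjOn e ((G.neighborFinset p).filter (· ∉ S) : Finset V) := by
      have hcard : ((G.neighborFinset p).filter (· ∉ S)).card ≤
          (({0, φ p} : Finset (Fin (n + 1)))ᶜ).card := by
        have h1 : (G.neighborFinset p).filter (· ∉ S) ⊆ (G.neighborFinset p).erase q := by
          intro v hv
          rw [Finset.mem_filter] at hv
          exact Finset.mem_erase.2 ⟨fun h => hv.2 (h ▸ hqS), hv.1⟩
        have h2 := Finset.card_le_card h1
        rw [Finset.card_erase_of_mem (by simpa using hpq), card_neighborFinset_eq_degree] at h2
        have h3 := hdeg p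
        have h4 : ({0, φ p} : Finset (Fin (n + 1))).card ≤ 2 := Finset.card_le_two
        rw [Finset.card_compl, Fintype.card_fin]
        omega
      obtain ⟨e, h1, h2⟩ := Finset.exists_injOn_of_card_le hcard
      exact ⟨e, h1, h2⟩
    simp only [Finset.mem_filter, mem_neighborFinset, Finset.mem_compl, Finset.mem_insert,
      Finset.mem_singleton, not_or] at heC
    by_cases hz : z ∉ S ∧ G.Adj p z
    · have hcp : c ≠ φ p := (hc hz.1 p hp hz.2.symm).symm
      have hez := heC z ⟨hz.2, hz.1⟩
      refine ⟨fun v => Equiv.swap (e z) c (e v), ?_, ?_, ?_, ?_⟩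
      · intro u v hu hv hpu hpv h
        exact heinj (by simp [hu, hpu]) (by simp [hv, hpv]) ((Equiv.swap _ _).injective h)
      · intro v hv hpv h
        rw [Equiv.swap_apply_eq_iff, Equiv.swap_apply_of_ne_of_ne (Ne.symm hez.2) hcp.symm] at h
        exact (heC v ⟨hpv, hv⟩).2 h
      · intro _ _
        exact Equiv.swap_apply_left _ _
      · intro v hv hpv hvz h
        rw [Equiv.swap_apply_eq_iff] at h
        by_cases hc0 : c = 0
        · rw [hc0, Equiv.swap_apply_right] at h
          exact hvz (heinj (by simp [hv, hpv]) (by simp [hz.1, hz.2]) h)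
        · rw [Equiv.swap_apply_of_ne_of_ne (Ne.symm hez.1) (Ne.symm hc0)] at h
          exact (heC v ⟨hpv, hv⟩).1 h
    · refine ⟨e, ?_, fun v hv hpv => (heC v ⟨hpv, hv⟩).2, fun h1 h2 => absurd ⟨h1, h2⟩ hz,
        fun v hv hpv _ => (heC v ⟨hpv, hv⟩).1⟩
      intro u v hu hv hpu hpv h
      exact heinj (by simp [hu, hpu]) (by simp [hv, hpv]) h
  obtain ⟨e, heinj, hep, hez, he0⟩ := he
  let T : V → Prop := fun v => ∀ w ∈ S, G.Adj v w → w = p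
  let ψ : V → Fin (n + 1) := fun v => if v ∈ S then φ v else if T v then e v else b v
  have hψS : ∀ v ∈ S, ψ v = φ v := fun v hv => if_pos hv
  have hψT : ∀ v, v ∉ S → T v → ψ v = e v := fun v hv hT => by simp only [ψ, if_neg hv, if_pos hT]
  have hψB : ∀ v, v ∉ S → ¬ T v → ψ v = b v := fun v hv hT => by
    simp only [ψ, if_neg hv, if_neg hT]
  have hnew : ∀ v, v ∉ S → G.Adj p v → ∀ w ∈ S, G.Adj v w → ψ v ≠ ψ w := by
    intro v hv hpv w hw hvw
    rw [hψS w hw]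
    by_cases hT : T v
    · rw [hψT v hv hT, hT w hw hvw]
      exact hep v hv hpv
    · rw [hψB v hv hT]
      exact (hbS v hv w hw hvw).symm
  have hpresc : z ∉ S → G.Adj p z → ψ z = c := by
    intro hz hpz
    by_cases hT : T z
    · rw [hψT z hz hT]
      exact hez hz hpz
    · rw [hψB z hz hT]
      exact hbz z hz rfl
  have hzero : ∀ v ∉ S, G.Adj p v → v ≠ z → ψ v = 0 →
      ∀ k ≠ 0, ∃ w ∈ S, G.Adj v w ∧ φ w = k := by
    intro v hv hpv hvz h0
    by_cases hT : T v
    · rw [hψT v hv hT] at h0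
      exact absurd h0 (he0 v hv hpv hvz)
    · rw [hψB v hv hT] at h0
      exact hb0 v hv hvz h0
  refine ⟨ψ, ⟨Set.subset_union_left, hψS, ?_, ?_, ?_, ?_⟩, hpresc, hzero⟩
  · intro u hu v hv huv
    by_cases huS : u ∈ S <;> by_cases hvS : v ∈ S
    · rw [hψS u huS, hψS v hvS]
      exact hφ u huS v hvS huv
    · exact (hnew v hvS (hv.resolve_left hvS) u huS huv.symm).symm
    · exact hnew u huS (hu.resolve_left huS) v hvS huv
    · exact absurd (hv.resolve_left hvS)
        (not_adj_of_five_le_girth hg (hu.resolve_left huS) huv)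
  · rintro v (hv | hv)
    · obtain ⟨w, hw, hvw⟩ := hS v hv
      exact ⟨w, Or.inl hw, hvw⟩
    · exact ⟨p, Or.inl hp, G.adj_symm hv⟩
  · intro v hv hvS hvu h0 k hk
    have hpv : G.Adj p v := hv.resolve_left hvS
    have hvz : v ≠ z := by
      rintro rfl
      exact hvu (hcu hvS ((hpresc hvS hpv).symm.trans h0))
    obtain ⟨w, hw, hvw, hwk⟩ := hzero v hvS hpv hvz h0 k hk
    exact ⟨w, Or.inl hw, hvw, (hψS w hw).trans hwk⟩
  · intro f hfS hfψ
    have hadj : ∀ v, ∀ w ∈ S, G.Adj w v → G.Adj w (f v) := fun v w hw h => by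
      simpa [hfS w hw] using f.map_adj_iff.2 h
    have hfB : ∀ v, G.Adj p v → ¬ T v → f v = v := by
      intro v hpv hT
      simp only [T, not_forall] at hT
      obtain ⟨w, hw, hvw, hwp⟩ := hT
      exact eq_of_common_adj_of_five_le_girth hg hwp (hadj v w hw hvw.symm) (hadj v p hp hpv)
        hvw.symm hpv
    intro v hvT
    by_cases hv : v ∈ S
    · exact hfS v hv
    have hpv : G.Adj p v := hvT.resolve_left hv
    by_cases hT : T v
    · have hfv : f v ∉ S := fun h => hv (f.injective (hfS _ h) ▸ h)
      have hpf := hadj v p hp hpv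
      by_cases hTf : T (f v)
      · have := hfψ v hvT (Or.inr hpf)
        rw [hψT v hv hT, hψT _ hfv hTf] at this
        exact heinj _ _ hfv hv hpf hpv this
      · exact f.injective (hfB _ hpf hTf)
    · exact hfB v hpv hT

/-- A partial proper coloring extends greedily to the whole graph. -/
lemma Connected.exists_extend_coloring [Fintype V] [DecidableRel G.Adj] (hconn : G.Connected)
    (hg : 5 ≤ G.girth) {n : ℕ} (hdeg : ∀ v, G.degree v ≤ n) (u : V) (S : Set V)
    (φ : V → Fin (n + 1)) (hφ : ∀ u ∈ S, ∀ v ∈ S, G.Adj u v → φ u ≠ φ v)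
    (hS : ∀ p ∈ S, ∃ q ∈ S, G.Adj p q) (hne : S.Nonempty) :
    ∃ ψ : V → Fin (n + 1), IsGreedyExtension G u S Set.univ φ ψ := by
  induction hm : Sᶜ.ncard using Nat.strong_induction_on generalizing S φ with
  | _ m ih =>
  by_cases huniv : ∀ v, v ∈ S
  · obtain rfl := Set.eq_univ_of_forall huniv
    exact ⟨φ, subset_rfl, fun _ _ => rfl, hφ, hS, fun v hv hv' => absurd hv hv',
      fun f hf _ => hf⟩
  obtain ⟨p, hp, x, hpx, hx⟩ : ∃ p ∈ S, ∃ x, G.Adj p x ∧ x ∉ S := by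
    by_contra! hcl
    obtain ⟨a, ha⟩ := hne
    exact huniv (hconn.mem_of_adj_closed hcl ha)
  obtain ⟨χ, hχ, -, -⟩ := exists_extend_neighbors hg hdeg hφ hS hp u p 0
    (fun h => absurd hp h) (fun h => absurd hp h)
  have hlt : (S ∪ G.neighborSet p)ᶜ.ncard < m := by
    rw [← hm]
    refine Set.ncard_lt_ncard ⟨Set.compl_subset_compl.2 Set.subset_union_left, fun h => ?_⟩
      (Set.toFinite _)
    exact h hx (Or.inr hpx)
  obtain ⟨ψ, hψ⟩ := ih _ hlt _ χ hχ.proper hχ.exists_adj (hne.mono Set.subset_union_left) rfl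
  exact ⟨ψ, hχ.trans hψ⟩

/-- The closed neighborhood of a vertex. -/
def closedNbhd (G : SimpleGraph V) (r : V) : Set V := {r} ∪ G.neighborSet r

lemma proper_on_closedNbhd (hg : 5 ≤ G.girth) {n : ℕ} {r : V} {φ : V → Fin (n + 1)}
    (hr : φ r = 0) (h0 : ∀ v, G.Adj r v → φ v ≠ 0) :
    ∀ v ∈ closedNbhd G r, ∀ w ∈ closedNbhd G r, G.Adj v w → φ v ≠ φ w := by
  rintro v (rfl | hv) w (rfl | hw) hvw
  · exact absurd hvw (G.irrefl)
  · rw [hr]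
    exact (h0 w hw).symm
  · rw [hr]
    exact h0 v hv
  · exact absurd hw (not_adj_of_five_le_girth hg hv hvw)

lemma exists_adj_on_closedNbhd {r x : V} (hx : G.Adj r x) :
    ∀ v ∈ closedNbhd G r, ∃ w ∈ closedNbhd G r, G.Adj v w := by
  rintro v (rfl | hv)
  · exact ⟨x, Or.inr hx, hx⟩
  · exact ⟨r, Or.inl rfl, G.adj_symm hv⟩

lemma Connected.exists_isProperDistinguishingColoring_of_degree_lt [Fintype V]
    [DecidableRel G.Adj] (hconn : G.Connected) (hg : 5 ≤ G.girth) {n : ℕ}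
    (hdeg : ∀ v, G.degree v ≤ n) {r x : V} (hx : G.Adj r x) (hr : G.degree r < n) :
    ∃ φ : V → Fin (n + 1), IsProperDistinguishingColoring G φ := by
  classical
  obtain ⟨e, heC, heinj⟩ := Finset.exists_injOn_of_card_le (s := G.neighborFinset r)
    (t := ({0} : Finset (Fin (n + 1)))ᶜ) (by
      rw [Finset.card_compl, Finset.card_singleton, Fintype.card_fin,
        card_neighborFinset_eq_degree]
      omega)
  simp only [mem_neighborFinset, Finset.mem_compl, Finset.mem_singleton] at heC
  let φ : V → Fin (n + 1) := fun v => if v = r then 0 else e v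
  have hφr : φ r = 0 := if_pos rfl
  have hφe : ∀ v, G.Adj r v → φ v = e v := fun v hv => if_neg hv.ne.symm
  obtain ⟨ψ, hψ⟩ := hconn.exists_extend_coloring hg hdeg r (closedNbhd G r) φ
    (proper_on_closedNbhd hg hφr fun v hv => by rw [hφe v hv]; exact heC v hv)
    (exists_adj_on_closedNbhd hx) ⟨r, Or.inl rfl⟩
  have hψr : ψ r = 0 := (hψ.agree r (Or.inl rfl)).trans hφr
  have hψe : ∀ v, G.Adj r v → ψ v = e v := fun v hv =>
    (hψ.agree v (Or.inr hv)).trans (hφe v hv)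
  refine ⟨ψ, fun v w => hψ.proper v trivial w trivial, fun f hf v => ?_⟩
  have hfr : f r = r := by
    by_contra hne
    have h0 : ψ (f r) = 0 := (hf r).trans hψr
    have hmem : f r ∉ closedNbhd G r := by
      rintro (h | h)
      · exact hne h
      · exact heC _ h ((hψe _ h).symm.trans h0)
    have hall := hψ.zero _ trivial hmem hne h0
    have hsub : ({0} : Finset (Fin (n + 1)))ᶜ ⊆ (G.neighborFinset (f r)).image ψ := by
      intro k hk
      obtain ⟨w, -, hw, hwk⟩ := hall k (by simpa using hk)
      exact Finset.mem_image.2 ⟨w, by simpa using hw, hwk⟩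
    have hcard := (Finset.card_le_card hsub).trans Finset.card_image_le
    rw [Finset.card_compl, Finset.card_singleton, Fintype.card_fin,
      card_neighborFinset_eq_degree, f.degree_eq] at hcard
    omega
  refine hψ.fixes f ?_ (fun v _ _ => hf v) v trivial
  rintro v (rfl | hv)
  · exact hfr
  · have hv : G.Adj r v := hv
    have hfv : G.Adj r (f v) := by simpa [hfr] using f.map_adj_iff.2 hv
    have := hf v
    rw [hψe v hv, hψe _ hfv] at this
    exact heinj (by simpa using hfv) (by simpa using hv) this

/-- A coloring of the closed neighborhood of `r` in which only the neighbors `x` and `y` share a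
color, and the color `d` is not used. -/
structure IsInitialColoring {n : ℕ} (G : SimpleGraph V) (r x y : V) (d : Fin (n + 1))
    (φ : V → Fin (n + 1)) : Prop where
  root : φ r = 0
  ne_zero : ∀ v, G.Adj r v → φ v ≠ 0
  ne_missing : ∀ v, G.Adj r v → φ v ≠ d
  eq : φ x = φ y
  inj : ∀ v w, G.Adj r v → G.Adj r w → φ v = φ w → v = w ∨ (v = x ∧ w = y) ∨ (v = y ∧ w = x)

lemma exists_isInitialColoring [Fintype V] [DecidableRel G.Adj] {n : ℕ}
    (hdeg : ∀ v, G.degree v ≤ n) {r x y : V} (hx : G.Adj r x) (hy : G.Adj r y) (hxy : x ≠ y)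
    (d : Fin (n + 1)) : ∃ φ : V → Fin (n + 1), IsInitialColoring G r x y d φ := by
  classical
  obtain ⟨e, heC, heinj⟩ := Finset.exists_injOn_of_card_le (s := (G.neighborFinset r).erase y)
    (t := ({0, d} : Finset (Fin (n + 1)))ᶜ) (by
      have h1 := hdeg r
      have h2 : ({0, d} : Finset (Fin (n + 1))).card ≤ 2 := Finset.card_le_two
      rw [Finset.card_compl, Fintype.card_fin, Finset.card_erase_of_mem (by simpa using hy),
        card_neighborFinset_eq_degree]
      omega)
  simp only [mem_neighborFinset, Finset.mem_compl, Finset.mem_singleton, Finset.mem_insert,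
    Finset.mem_erase, not_or] at heC
  let φ : V → Fin (n + 1) := fun v => if v = r then 0 else if v = y then e x else e v
  have hφy : φ y = e x := by simp [φ, hy.ne.symm]
  have hφe : ∀ v, G.Adj r v → v ≠ y → φ v = e v := fun v hv hvy => by
    simp [φ, hv.ne.symm, hvy]
  have hC : ∀ v, G.Adj r v → φ v ≠ 0 ∧ φ v ≠ d := by
    intro v hv
    by_cases hvy : v = y
    · rw [hvy, hφy]
      exact heC x ⟨hxy, hx⟩
    · rw [hφe v hv hvy]
      exact heC v ⟨hvy, hv⟩
  have hinj : ∀ v w, G.Adj r v → G.Adj r w → v ≠ y → w ≠ y → e v = e w → v = w :=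
    fun v w hv hw hvy hwy h => heinj (by simp [hv, hvy]) (by simp [hw, hwy]) h
  refine ⟨φ, if_pos rfl, fun v hv => (hC v hv).1, fun v hv => (hC v hv).2,
    (hφe x hx hxy).trans hφy.symm, ?_⟩
  intro v w hv hw h
  by_cases hvy : v = y <;> by_cases hwy : w = y
  · exact Or.inl (hvy.trans hwy.symm)
  · rw [hvy, hφy, hφe w hw hwy] at h
    exact Or.inr (Or.inr ⟨hvy, (hinj x w hx hw hxy hwy h).symm⟩)
  · rw [hwy, hφy, hφe v hv hvy] at h
    exact Or.inr (Or.inl ⟨hinj v x hv hx hvy hxy h, hwy⟩)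
  · rw [hφe v hv hvy, hφe w hw hwy] at h
    exact Or.inl (hinj v w hv hw hvy hwy h)

/-- If `u`, a neighbor of `y`, has color `0` and sees the color `d`, and `x` has no neighbor of
color `0` other than `r`, then `r`, `x` and `y` are determined by the coloring. -/
lemma Connected.exists_isProperDistinguishingColoring_of_isGreedyExtension [Fintype V]
    [DecidableRel G.Adj] (hconn : G.Connected) (hg : 5 ≤ G.girth) {n : ℕ}
    (hdeg : ∀ v, G.degree v ≤ n) {r x y u z : V} {d : Fin (n + 1)} {T : Set V}
    {φ ψ : V → Fin (n + 1)} (hd : d ≠ 0) (hyu : G.Adj y u) (hur : u ≠ r)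
    (hφ : IsInitialColoring G r x y d φ)
    (hψ : IsGreedyExtension G u (closedNbhd G r) T φ ψ) (hxT : G.neighborSet x ⊆ T)
    (huT : u ∈ T) (hu : ψ u = 0) (hx0 : ∀ v, G.Adj x v → ψ v = 0 → v = r)
    (hz : z ∈ T) (huz : G.Adj u z) (hzd : ψ z = d) :
    ∃ φ : V → Fin (n + 1), IsProperDistinguishingColoring G φ := by
  have hrT : r ∈ T := hψ.subset (Or.inl rfl)
  obtain ⟨χ, hχ⟩ := hconn.exists_extend_coloring hg hdeg u T ψ hψ.proper hψ.exists_adj ⟨r, hrT⟩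
  have h := hψ.trans hχ
  have hχN : ∀ v, G.Adj r v → χ v = φ v := fun v hv => h.agree v (Or.inr hv)
  have hχr : χ r = 0 := (h.agree r (Or.inl rfl)).trans hφ.root
  have hχu : χ u = 0 := (hχ.agree u huT).trans hu
  have hχx : ∀ v, G.Adj x v → χ v = 0 → v = r := fun v hv h0 =>
    hx0 v hv ((hχ.agree v (hxT hv)).symm.trans h0)
  refine ⟨χ, fun v w => h.proper v trivial w trivial, fun f hf v => ?_⟩
  have hfr : f r = r := by
    by_contra hne
    have h0 : χ (f r) = 0 := (hf r).trans hχr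
    obtain ⟨w, hw, hwd⟩ : ∃ w, G.Adj (f r) w ∧ χ w = d := by
      by_cases hfu : f r = u
      · exact ⟨z, hfu ▸ huz, (hχ.agree z hz).trans hzd⟩
      · have hmem : f r ∉ closedNbhd G r := by
          rintro (h' | h')
          · exact hne h'
          · exact hφ.ne_zero _ h' ((hχN _ h').symm.trans h0)
        obtain ⟨w, -, hw, hwd⟩ := h.zero _ trivial hmem hfu h0 d hd
        exact ⟨w, hw, hwd⟩
    obtain ⟨w, rfl⟩ := f.surjective w
    have hrw : G.Adj r w := f.map_adj_iff.1 hw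
    exact hφ.ne_missing w hrw (((hχN w hrw).symm.trans (hf w).symm).trans hwd)
  have hfN : ∀ v, G.Adj r v → G.Adj r (f v) := fun v hv => by
    simpa [hfr] using f.map_adj_iff.2 hv
  have hyx : G.Adj r x → G.Adj r y → f y ≠ x := by
    intro _ _ hyx
    have hxu : G.Adj x (f u) := hyx ▸ f.map_adj_iff.2 hyu
    exact hur (f.injective ((hχx _ hxu ((hf u).trans hχu)).trans hfr.symm))
  refine h.fixes f ?_ (fun v _ _ => hf v) v trivial
  rintro v (rfl | hv)
  · exact hfr
  · have hv : G.Adj r v := hv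
    have heq := hf v
    rw [hχN v hv, hχN _ (hfN v hv)] at heq
    rcases hφ.inj _ _ (hfN v hv) hv heq with h1 | ⟨h1, h2⟩ | ⟨h1, h2⟩
    · exact h1
    · subst h2
      exact absurd h1 (hyx (h1 ▸ hfN _ hv) hv)
    · subst h2
      have hry : G.Adj r y := h1 ▸ hfN _ hv
      have heq := hf y
      rw [hχN y hry, hχN _ (hfN y hry)] at heq
      rcases hφ.inj _ _ (hfN y hry) hry heq with h3 | ⟨h3, -⟩ | ⟨h3, h4⟩
      · rw [h1, f.injective (h3.trans h1.symm)]
      · exact absurd h3 (hyx hv hry)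
      · rw [h1, h4]

lemma exists_extend_initialColoring [Fintype V] [DecidableRel G.Adj] (hg : 5 ≤ G.girth) {n : ℕ}
    (hdeg : ∀ v, G.degree v ≤ n) {r x y u : V} {d : Fin (n + 1)} {φ : V → Fin (n + 1)}
    (hy : G.Adj r y) (hyu : G.Adj y u) (hur : u ≠ r) (hφ : IsInitialColoring G r x y d φ) :
    ∃ ψ : V → Fin (n + 1), ψ u = 0 ∧
      IsGreedyExtension G u (closedNbhd G r) (closedNbhd G r ∪ G.neighborSet y) φ ψ := by
  have hru : ¬ G.Adj r u := not_adj_of_five_le_girth hg hy hyu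
  have hu : u ∉ closedNbhd G r := by
    rintro (h | h)
    exacts [hur h, hru h]
  obtain ⟨ψ, hψ, hψu, -⟩ := exists_extend_neighbors hg hdeg
    (proper_on_closedNbhd hg hφ.root hφ.ne_zero) (exists_adj_on_closedNbhd hy) (Or.inr hy) u u 0
    (fun _ _ => rfl) (by
      rintro - w (rfl | hw) huw
      · exact absurd huw.symm hru
      · exact hφ.ne_zero w hw)
  exact ⟨ψ, hψu hu hyu, hψ⟩

lemma exists_adj_ne_of_two_le_degree [Fintype V] [DecidableRel G.Adj] {v : V}
    (h : 2 ≤ G.degree v) (a : V) : ∃ b, G.Adj v b ∧ b ≠ a := by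
  rw [← card_neighborFinset_eq_degree] at h
  obtain ⟨b, hb, hba⟩ := Finset.exists_mem_ne (Nat.lt_of_succ_le h) a
  exact ⟨b, by simpa using hb, hba⟩

lemma eq_of_adj_of_mem_closedNbhd_union (hg : 5 ≤ G.girth) {r x y v : V} (hx : G.Adj r x)
    (hy : G.Adj r y) (hxy : x ≠ y) (hxv : G.Adj x v)
    (hv : v ∈ closedNbhd G r ∪ G.neighborSet y) : v = r := by
  rcases hv with (h | h) | h
  · exact h
  · exact absurd h (not_adj_of_five_le_girth hg hx hxv)
  · exact eq_of_common_adj_of_five_le_girth hg hxy hxv h hx.symm hy.symm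

lemma eq_or_adj_of_adj_of_mem_closedNbhd_union (hg : 5 ≤ G.girth) {r x y v q : V}
    (hx : G.Adj r x) (hxv : G.Adj x v) (hv : v ∉ closedNbhd G r ∪ G.neighborSet y)
    (hq : q ∈ closedNbhd G r ∪ G.neighborSet y) (hvq : G.Adj v q) : q = x ∨ G.Adj y q := by
  rcases hq with (h | h) | h
  · obtain rfl : q = r := h
    exact absurd (Or.inl (Or.inr hvq.symm)) hv
  · refine Or.inl (eq_of_common_adj_of_five_le_girth hg (p := r) (q := v) ?_ h hvq hx hxv.symm)
    rintro rfl
    exact hv (Or.inl (Or.inl rfl))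
  · exact Or.inr h

lemma Connected.exists_isProperDistinguishingColoring_of_pentagon [Fintype V]
    [DecidableRel G.Adj] (hconn : G.Connected) (hg : 5 ≤ G.girth) {n : ℕ} (hn : 2 ≤ n)
    (hdeg : ∀ v, G.degree v ≤ n) {r y u w x : V} (hy : G.Adj r y) (hyu : G.Adj y u)
    (huw : G.Adj u w) (hwx : G.Adj w x) (hxr : G.Adj x r) :
    ∃ φ : V → Fin (n + 1), IsProperDistinguishingColoring G φ := by
  classical
  have hx := hxr.symm
  have hxw := hwx.symm
  have hwr : ¬ G.Adj r w := not_adj_of_five_le_girth hg hx hxw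
  have hyw : ¬ G.Adj y w := not_adj_of_five_le_girth hg hyu huw
  have hxy : x ≠ y := fun h => hyw (h ▸ hxw)
  have hur : u ≠ r := fun h => hwr (h ▸ huw)
  have hwr' : w ≠ r := fun h => not_adj_of_five_le_girth hg hy hyu (h ▸ huw.symm)
  have hwy : y ≠ w := fun h => not_adj_of_five_le_girth hg hy (h ▸ hwx) hx
  have hd : Fin.last n ≠ 0 := by
    rw [Ne, Fin.ext_iff]
    simp only [Fin.val_last, Fin.val_zero]
    omega
  obtain ⟨φ, hφ⟩ := exists_isInitialColoring hdeg hx hy hxy (Fin.last n)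
  obtain ⟨ψ, hψu, hψ⟩ := exists_extend_initialColoring hg hdeg hy hyu hur hφ
  have hwS : w ∉ closedNbhd G r ∪ G.neighborSet y := fun h =>
    hwr' (eq_of_adj_of_mem_closedNbhd_union hg hx hy hxy hxw h)
  have hxS : x ∈ closedNbhd G r ∪ G.neighborSet y := Or.inl (Or.inr hx)
  have hψx : ψ x ≠ Fin.last n := by
    rw [hψ.agree x (Or.inr hx)]
    exact hφ.ne_missing x hx
  obtain ⟨χ, hχ, hχw, hχ0⟩ := exists_extend_neighbors hg hdeg hψ.proper hψ.exists_adj hxS u w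
    (Fin.last n) (fun _ h => absurd h hd) (by
      intro _ v hv hwv
      rcases eq_or_adj_of_adj_of_mem_closedNbhd_union hg hx hxw hwS hv hwv with rfl | hyv
      · exact hψx
      · rw [eq_of_common_adj_of_five_le_girth hg hwy hyv hwv hyu huw.symm, hψu]
        exact hd.symm)
  replace hχw := hχw hwS hxw
  have huS : u ∈ closedNbhd G r ∪ G.neighborSet y := Or.inr hyu
  refine hconn.exists_isProperDistinguishingColoring_of_isGreedyExtension hg hdeg hd hyu hur hφ
    (hψ.trans hχ) Set.subset_union_right (Or.inl huS) ((hχ.agree u huS).trans hψu) ?_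
    (Or.inr hxw) huw hχw
  intro v hxv hv0
  by_cases hvS : v ∈ closedNbhd G r ∪ G.neighborSet y
  · exact eq_of_adj_of_mem_closedNbhd_union hg hx hy hxy hxv hvS
  exfalso
  have hvw : v ≠ w := by
    rintro rfl
    exact hd (hχw.symm.trans hv0)
  have hvr : v ≠ r := by
    rintro rfl
    exact hvS (Or.inl (Or.inl rfl))
  have hvy : y ≠ v := by
    rintro rfl
    exact hvS (Or.inl (Or.inr hy))
  have hn3 : 3 ≤ n := by
    have hsub : ({r, w, v} : Finset V) ⊆ G.neighborFinset x := by
      intro a ha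
      simp only [Finset.mem_insert, Finset.mem_singleton] at ha
      rw [mem_neighborFinset]
      rcases ha with rfl | rfl | rfl
      exacts [hxr, hxw, hxv]
    have h1 := Finset.card_le_card hsub
    rw [card_neighborFinset_eq_degree, Finset.card_eq_three.2
      ⟨r, w, v, hwr'.symm, hvr.symm, hvw.symm, rfl⟩] at h1
    exact h1.trans (hdeg x)
  have hsee := hχ0 v hvS hxv hvw hv0
  have hsee' : ∀ k ≠ 0, k ≠ ψ x → ∃ q, G.Adj v q ∧ G.Adj y q ∧ ψ q = k := by
    intro k hk hkx
    obtain ⟨q, hq, hvq, hqk⟩ := hsee k hk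
    rcases eq_or_adj_of_adj_of_mem_closedNbhd_union hg hx hxv hvS hq hvq with rfl | hyq
    · exact absurd hqk.symm hkx
    · exact ⟨q, hvq, hyq, hqk⟩
  obtain ⟨k, hk⟩ := Finset.exists_notMem_of_card_lt
    (s := ({0, ψ x, Fin.last n} : Finset (Fin (n + 1)))) (by
      rw [Fintype.card_fin]
      exact Finset.card_le_three.trans_lt (Nat.lt_succ_of_le hn3))
  simp only [Finset.mem_insert, Finset.mem_singleton, not_or] at hk
  obtain ⟨q, hvq, hyq, hqk⟩ := hsee' k hk.1 hk.2.1
  obtain ⟨q', hvq', hyq', hqk'⟩ := hsee' (Fin.last n) hd hψx.symm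
  rw [eq_of_common_adj_of_five_le_girth hg hvy hyq hvq hyq' hvq', hqk'] at hqk
  exact hk.2.2 hqk.symm

lemma Connected.exists_isProperDistinguishingColoring_of_no_pentagon [Fintype V]
    [DecidableRel G.Adj] (hconn : G.Connected) (hg : 5 ≤ G.girth) {n : ℕ} (hn : 2 ≤ n)
    (hdeg : ∀ v, G.degree v = n) (hC6 : ¬ Nonempty (G ≃g cycleGraph 6))
    (h5 : ∀ a b c d e, G.Adj a b → G.Adj b c → G.Adj c d → G.Adj d e → ¬ G.Adj e a) :
    ∃ φ : V → Fin (n + 1), IsProperDistinguishingColoring G φ := by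
  classical
  have hdeg' : ∀ v, G.degree v ≤ n := fun v => (hdeg v).le
  have hdeg2 : ∀ v, 2 ≤ G.degree v := fun v => (hdeg v).symm ▸ hn
  obtain ⟨r⟩ := hconn.nonempty
  obtain ⟨y, hy, -⟩ := exists_adj_ne_of_two_le_degree (hdeg2 r) r
  obtain ⟨x, hx, hxy⟩ := exists_adj_ne_of_two_le_degree (hdeg2 r) y
  obtain ⟨u, hyu, hur⟩ := exists_adj_ne_of_two_le_degree (hdeg2 y) r
  obtain ⟨z, huz, hzy⟩ := exists_adj_ne_of_two_le_degree (hdeg2 u) y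
  have hru : ¬ G.Adj r u := not_adj_of_five_le_girth hg hy hyu
  have hyz : ¬ G.Adj y z := not_adj_of_five_le_girth hg hyu huz
  have hxu : ¬ G.Adj x u := fun h =>
    hxy (eq_of_common_adj_of_five_le_girth hg hur.symm hx h.symm hy hyu.symm)
  have hrz : ¬ G.Adj r z := fun h =>
    hzy (eq_of_common_adj_of_five_le_girth hg hur.symm h huz hy hyu.symm)
  have hzr : z ≠ r := fun h => hru (h ▸ huz.symm)
  have hzx : z ≠ x := fun h => hrz (h ▸ hx)
  have hxz : ¬ G.Adj x z := fun h => h5 r y u z x hy hyu huz h.symm hx.symm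
  have hd : Fin.last n ≠ 0 := by
    rw [Ne, Fin.ext_iff]
    simp only [Fin.val_last, Fin.val_zero]
    omega
  obtain ⟨φ, hφ⟩ := exists_isInitialColoring hdeg' hx hy hxy (Fin.last n)
  obtain ⟨ψ, hψu, hψ⟩ := exists_extend_initialColoring hg hdeg' hy hyu hur hφ
  have hψx : ψ x = φ x := hψ.agree x (Or.inr hx)
  have hxS : x ∈ closedNbhd G r ∪ G.neighborSet y := Or.inl (Or.inr hx)
  have huS : u ∈ closedNbhd G r ∪ G.neighborSet y := Or.inr hyu
  have hNx : ∀ v, G.Adj x v → v ∉ closedNbhd G r ∪ G.neighborSet y →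
      ∀ q ∈ closedNbhd G r ∪ G.neighborSet y, G.Adj v q → q = x := by
    intro v hxv hv q hq hvq
    refine (eq_or_adj_of_adj_of_mem_closedNbhd_union hg hx hxv hv hq hvq).resolve_right ?_
    exact fun hyq => h5 r y q v x hy hyq hvq.symm hxv.symm hx.symm
  -- the common neighbor of `x` and `z`, if any, must not have the color `Fin.last n`
  obtain ⟨w, c, hc0, hcx, hwx, hwc⟩ : ∃ (w : V) (c : Fin (n + 1)), c ≠ 0 ∧ φ x ≠ c ∧
      (w = x ∨ G.Adj x w) ∧ ∀ v, G.Adj z v → G.Adj x v → v = w ∧ c ≠ Fin.last n := by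
    by_cases hw : ∃ w, G.Adj z w ∧ G.Adj x w
    · obtain ⟨w, hzw, hxw⟩ := hw
      have hn3 : 3 ≤ n := by
        by_contra hlt
        refine hC6 (hconn.nonempty_iso_cycleGraph_six (fun v => (hdeg' v).trans (by omega))
          ![r, y, u, z, w, x] ?_ ?_)
        · have hwr : w ≠ r := fun h => hrz (h ▸ hzw.symm)
          have hwy : w ≠ y := fun h => hyz (h ▸ hzw.symm)
          have hwu : w ≠ u := fun h => hxu (h ▸ hxw)
          have hux : u ≠ x := fun h => hxz (h ▸ huz)
          rw [← List.nodup_ofFn]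
          simp [hy.ne, hx.ne, hyu.ne, huz.ne, hzw.ne, hxw.ne.symm, hur.symm, hzr.symm,
            hwr.symm, hzy.symm, hwy.symm, hxy.symm, hwu.symm, hux, hzx]
        · intro i
          fin_cases i
          exacts [hy, hyu, huz, hzw, hxw.symm, hx.symm]
      obtain ⟨c, hc⟩ := Finset.exists_notMem_of_card_lt
        (s := ({0, φ x, Fin.last n} : Finset (Fin (n + 1)))) (by
          rw [Fintype.card_fin]
          exact Finset.card_le_three.trans_lt (Nat.lt_succ_of_le hn3))
      simp only [Finset.mem_insert, Finset.mem_singleton, not_or] at hc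
      exact ⟨w, c, hc.1, Ne.symm hc.2.1, Or.inr hxw, fun v hzv hxv =>
        ⟨eq_of_common_adj_of_five_le_girth hg hzx hzv hxv hzw hxw, hc.2.2⟩⟩
    · exact ⟨x, Fin.last n, hd, hφ.ne_missing x hx, Or.inl rfl,
        fun v hzv hxv => absurd ⟨v, hzv, hxv⟩ hw⟩
  obtain ⟨χ, hχ, hχw, hχ0⟩ := exists_extend_neighbors hg hdeg' hψ.proper hψ.exists_adj hxS u w c
    (fun _ h => absurd h hc0) (by
      intro hwS v hv hwv
      have hxw : G.Adj x w := hwx.resolve_left fun h => hwS (h ▸ hxS)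
      rw [hNx w hxw hwS v hv hwv, hψx]
      exact hcx)
  have hzS : z ∉ (closedNbhd G r ∪ G.neighborSet y) ∪ G.neighborSet x := by
    rintro (((h | h) | h) | h)
    exacts [hzr h, hrz h, hyz h, hxz h]
  obtain ⟨ω, hω, hωz, -⟩ := exists_extend_neighbors hg hdeg' hχ.proper hχ.exists_adj
    (Or.inl huS) u z (Fin.last n) (fun _ h => absurd h hd) (by
      rintro - v (((h | h) | h) | h) hzv
      · obtain rfl : v = r := h
        exact absurd hzv.symm hrz
      · exact absurd h.symm (h5 r y u z v hy hyu huz hzv)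
      · rw [eq_of_common_adj_of_five_le_girth hg hzy.symm h hzv hyu huz.symm,
          hχ.agree u huS, hψu]
        exact hd.symm
      · obtain ⟨rfl, hcd⟩ := hwc v hzv h
        rw [hχw (fun hvS => hrz (eq_of_adj_of_mem_closedNbhd_union hg hx hy hxy h hvS ▸
          hzv.symm)) h]
        exact hcd)
  refine hconn.exists_isProperDistinguishingColoring_of_isGreedyExtension hg hdeg' hd hyu hur hφ
    ((hψ.trans hχ).trans hω) (Set.subset_union_right.trans Set.subset_union_left)
    (Or.inl (Or.inl huS)) ?_ ?_ (Or.inr huz) huz (hωz hzS huz)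
  · rw [hω.agree u (Or.inl huS), hχ.agree u huS, hψu]
  · intro v hxv hv0
    rw [hω.agree v (Or.inr hxv)] at hv0
    by_cases hvS : v ∈ closedNbhd G r ∪ G.neighborSet y
    · exact eq_of_adj_of_mem_closedNbhd_union hg hx hy hxy hxv hvS
    exfalso
    have hvw : v ≠ w := by
      rintro rfl
      exact hc0 ((hχw hvS hxv).symm.trans hv0)
    obtain ⟨q, hq, hvq, hqd⟩ := hχ0 v hvS hxv hvw hv0 (Fin.last n) hd
    rw [hNx v hxv hvS q hq hvq, hψx] at hqd
    exact hφ.ne_missing x hx hqd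

lemma exists_two_le_degree_of_five_le_girth [Fintype V] [DecidableRel G.Adj]
    (hg : 5 ≤ G.girth) : ∃ v, 2 ≤ G.degree v := by
  classical
  have hcyc : ¬ G.IsAcyclic := fun h => by
    rw [← girth_eq_zero] at h
    omega
  obtain ⟨v, p, hp, -⟩ := exists_girth_eq_length.2 hcyc
  refine ⟨v, ?_⟩
  have hsub : ({p.snd, p.penultimate} : Finset V) ⊆ G.neighborFinset v := by
    intro w hw
    simp only [Finset.mem_insert, Finset.mem_singleton] at hw
    rw [mem_neighborFinset]
    rcases hw with rfl | rfl
    · exact p.adj_snd hp.not_nil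
    · exact (p.adj_penultimate hp.not_nil).symm
  have h := Finset.card_le_card hsub
  rwa [Finset.card_pair hp.snd_ne_penultimate, card_neighborFinset_eq_degree] at h

end SimpleGraph

/-- If `G` is connected with girth at least 5 and `G ≠ C₆`, then `χ_D(G) ≤ Δ(G) + 1`. -/
theorem chiD_le_maxDegree_add_one_of_girth_ge_five {V : Type*} [Fintype V] [DecidableEq V]
    (G : SimpleGraph V) [DecidableRel G.Adj]
    (hconn : G.Connected) (hgirth : 5 ≤ G.girth)
    (hC6 : ¬ Nonempty (G ≃g SimpleGraph.cycleGraph 6)) :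
    ∃ φ : V → Fin (G.maxDegree + 1), IsProperDistinguishingColoring G φ := by
  obtain ⟨v, hv⟩ := SimpleGraph.exists_two_le_degree_of_five_le_girth hgirth
  have hn : 2 ≤ G.maxDegree := hv.trans (G.degree_le_maxDegree v)
  by_cases hreg : ∀ r, G.degree r = G.maxDegree
  · by_cases h5 : ∃ a b c d e, G.Adj a b ∧ G.Adj b c ∧ G.Adj c d ∧ G.Adj d e ∧ G.Adj e a
    · obtain ⟨a, b, c, d, e, hab, hbc, hcd, hde, hea⟩ := h5
      exact hconn.exists_isProperDistinguishingColoring_of_pentagon hgirth hn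
        G.degree_le_maxDegree hab hbc hcd hde hea
    · exact hconn.exists_isProperDistinguishingColoring_of_no_pentagon hgirth hn hreg hC6
        fun a b c d e hab hbc hcd hde hea => h5 ⟨a, b, c, d, e, hab, hbc, hcd, hde, hea⟩
  · push Not at hreg
    obtain ⟨r, hr⟩ := hreg
    obtain ⟨x, hx⟩ : ∃ x, G.Adj r x := by
      have : Nontrivial V := by
        have h := Finset.one_lt_card.1 (Nat.lt_of_succ_le
          (G.card_neighborFinset_eq_degree v ▸ hv))
        obtain ⟨a, -, b, -, hab⟩ := h
        exact ⟨a, b, hab⟩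
      exact (G.degree_pos_iff_exists_adj r).1 (hconn.preconnected.degree_pos_of_nontrivial r)
    exact hconn.exists_isProperDistinguishingColoring_of_degree_lt hgirth G.degree_le_maxDegree hx
      (lt_of_le_of_ne (G.degree_le_maxDegree r) hr)
end

section
/- If G is a connected finite simple graph with girth at least 5, then χ_D(G) ≤ Δ(G) + 2, where Δ(G) is the maximum degree of G. -/
/-- In a graph of girth at least 5, two distinct vertices have at most one common neighbor. -/
theorem SimpleGraph.eq_of_common_neighbors_of_five_le_girth {V : Type*} {G : SimpleGraph V}
    (hgirth : 5 ≤ G.girth) {a b x y : V} (hab : a ≠ b)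
    (hxa : G.Adj x a) (hxb : G.Adj x b) (hya : G.Adj y a) (hyb : G.Adj y b) : x = y := by
  by_contra hxy
  let p : G.Walk x x := .cons hxa (.cons hya.symm (.cons hyb (.cons hxb.symm .nil)))
  have hp : p.IsCycle := by
    have := hxa.ne
    have := hxb.ne
    have := hya.ne
    have := hyb.ne
    rw [SimpleGraph.Walk.cons_isCycle_iff]
    constructor
    · simp [SimpleGraph.Walk.cons_isPath_iff]
      grind
    · simp
      grind
  have h : G.girth ≤ 4 := hp.girth_le_length
  omega

/-- A partial coloring `c`, relevant only on `S`, which is proper on `S`, uses color `z` exactly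
at `r`, and has the property that every automorphism preserving an extension of `c` in which
`z` is still used only at `r` fixes `S` pointwise. -/
structure IsFixingColoring {V α : Type*} (G : SimpleGraph V) (r : V) (z : α) (S : Set V)
    (c : V → α) : Prop where
  root_mem : r ∈ S
  eq_root_iff : ∀ x ∈ S, c x = z ↔ x = r
  proper : ∀ x ∈ S, ∀ y ∈ S, G.Adj x y → c x ≠ c y
  fixes : ∀ c' : V → α, (∀ x ∈ S, c' x = c x) → (∀ x, c' x = z → x = r) →
    ∀ f : G ≃g G, (∀ v, c' (f v) = c' v) → ∀ x ∈ S, f x = x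

theorem isFixingColoring_singleton {V α : Type*} (G : SimpleGraph V) (r : V) (z : α) :
    IsFixingColoring G r z {r} (fun _ => z) where
  root_mem := rfl
  eq_root_iff := by simp
  proper := by simp
  fixes := by
    rintro c' hc hz f hf x rfl
    exact hz _ ((hf x).trans (hc x rfl))

/-- A vertex with two neighbors in `S` can be added to `S`. -/
theorem IsFixingColoring.exists_insert {V : Type*} [Fintype V] {G : SimpleGraph V}
    [DecidableRel G.Adj] (hgirth : 5 ≤ G.girth) {r : V} {z : Fin (G.maxDegree + 2)} {S : Set V}
    {c : V → Fin (G.maxDegree + 2)} (h : IsFixingColoring G r z S c) {w a b : V} (hw : w ∉ S)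
    (ha : a ∈ S) (hb : b ∈ S) (hab : a ≠ b) (hwa : G.Adj w a) (hwb : G.Adj w b) :
    ∃ c', IsFixingColoring G r z (insert w S) c' := by
  classical
  obtain ⟨k, -, hk⟩ : ∃ k ∈ Finset.univ, k ∉ insert z ((G.neighborFinset w).image c) := by
    apply Finset.exists_mem_notMem_of_card_lt_card
    have h1 := Finset.card_insert_le z ((G.neighborFinset w).image c)
    have h2 := Finset.card_image_le (s := G.neighborFinset w) (f := c)
    have h3 := G.degree_le_maxDegree w
    rw [G.card_neighborFinset_eq_degree] at h2
    simp only [Finset.card_univ, Fintype.card_fin]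
    omega
  simp only [Finset.mem_insert, Finset.mem_image, SimpleGraph.mem_neighborFinset, not_or,
    not_exists, not_and] at hk
  have hne : ∀ x ∈ S, x ≠ w := fun x hx e => hw (e ▸ hx)
  have hold : ∀ x ∈ S, Function.update c w k x = c x := fun x hx =>
    Function.update_of_ne (hne x hx) _ _
  refine ⟨Function.update c w k, Or.inr h.root_mem, ?_, ?_, ?_⟩
  · rintro x (rfl | hx)
    · have := hne r h.root_mem
      simp [hk.1, this.symm]
    · rw [hold x hx, h.eq_root_iff x hx]
  · rintro x (rfl | hx) y (rfl | hy) hxy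
    · exact (hxy.ne rfl).elim
    · rw [hold y hy, Function.update_self]
      exact fun e => hk.2 y hxy e.symm
    · rw [hold x hx, Function.update_self]
      exact hk.2 x hxy.symm
    · rw [hold x hx, hold y hy]
      exact h.proper x hx y hy hxy
  · intro c' hc hz f hf
    have hfix := h.fixes c' (fun x hx => (hc x (Or.inr hx)).trans (hold x hx)) hz f hf
    rintro x (rfl | hx)
    · have hfa := f.map_adj_iff.2 hwa
      have hfb := f.map_adj_iff.2 hwb
      rw [hfix a ha] at hfa
      rw [hfix b hb] at hfb
      exact SimpleGraph.eq_of_common_neighbors_of_five_le_girth hgirth hab hfa hfb hwa hwb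
    · exact hfix x hx

/-- If no vertex outside `S` has two neighbors in `S`, then all neighbors of a vertex of `S` can be
added to `S` at once, with distinct colors. -/
theorem IsFixingColoring.exists_union_neighborSet {V : Type*} [Fintype V] {G : SimpleGraph V}
    [DecidableRel G.Adj] {r : V} {z : Fin (G.maxDegree + 2)} {S : Set V}
    {c : V → Fin (G.maxDegree + 2)} (h : IsFixingColoring G r z S c)
    (hS : ∀ w ∉ S, ∀ a ∈ S, ∀ b ∈ S, G.Adj w a → G.Adj w b → a = b) {v : V} (hv : v ∈ S) :
    ∃ c', IsFixingColoring G r z (S ∪ G.neighborSet v) c' := by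
  classical
  obtain ⟨g, hg, hinj⟩ : ∃ g : V → Fin (G.maxDegree + 2),
      (∀ x ∈ G.neighborFinset v, g x ∈ Finset.univ \ {z, c v}) ∧
        Set.InjOn g (G.neighborFinset v) := by
    have hcard : (G.neighborFinset v).card ≤ (Finset.univ \ {z, c v}).card := by
      have h1 := Finset.le_card_sdiff {z, c v} (Finset.univ : Finset (Fin (G.maxDegree + 2)))
      have h2 := Finset.card_le_two (a := z) (b := c v)
      have h3 := G.degree_le_maxDegree v
      rw [G.card_neighborFinset_eq_degree]
      simp only [Finset.card_univ, Fintype.card_fin] at h1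
      omega
    have hencard : (G.neighborFinset v : Set V).encard ≤
        (↑(Finset.univ \ {z, c v}) : Set (Fin (G.maxDegree + 2))).encard := by
      rw [Set.encard_coe_eq_coe_finsetCard, Set.encard_coe_eq_coe_finsetCard]
      exact_mod_cast hcard
    obtain ⟨g, hg, hinj⟩ := (Finset.finite_toSet _).exists_injOn_of_encard_le hencard
    exact ⟨g, fun x hx => hg hx, hinj⟩
  simp only [SimpleGraph.mem_neighborFinset, Finset.mem_sdiff, Finset.mem_univ, true_and,
    Finset.mem_insert, Finset.mem_singleton, not_or] at hg
  let d : V → Fin (G.maxDegree + 2) := fun x => if x ∈ S then c x else g x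
  have hold : ∀ x ∈ S, d x = c x := fun x hx => if_pos hx
  have hnew : ∀ x ∉ S, d x = g x := fun x hx => if_neg hx
  have hd : ∀ x ∉ S, G.Adj v x → ∀ y ∉ S, G.Adj v y → d x = d y → x = y := by
    intro x hx hvx y hy hvy e
    rw [hnew x hx, hnew y hy] at e
    exact hinj (by simpa using hvx) (by simpa using hvy) e
  have hcross : ∀ x ∈ S, ∀ y ∉ S, G.Adj v y → G.Adj x y → d x ≠ d y := by
    intro x hx y hy hvy hxy e
    obtain rfl := hS y hy v hv x hx hvy.symm hxy.symm
    rw [hold v hx, hnew y hy] at e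
    exact (hg y hvy).2 e.symm
  refine ⟨d, Or.inl h.root_mem, ?_, ?_, ?_⟩
  · intro x hx
    by_cases hxS : x ∈ S
    · rw [hold x hxS, h.eq_root_iff x hxS]
    · have hvx : G.Adj v x := hx.resolve_left hxS
      rw [hnew x hxS]
      exact ⟨fun e => ((hg x hvx).1 e).elim, fun e => (hxS (e ▸ h.root_mem)).elim⟩
  · intro x hx y hy hxy
    by_cases hxS : x ∈ S <;> by_cases hyS : y ∈ S
    · rw [hold x hxS, hold y hyS]
      exact h.proper x hxS y hyS hxy
    · exact hcross x hxS y hyS (hy.resolve_left hyS) hxy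
    · exact (hcross y hyS x hxS (hx.resolve_left hxS) hxy.symm).symm
    · exact fun e => hxy.ne (hd x hxS (hx.resolve_left hxS) y hyS (hy.resolve_left hyS) e)
  · intro c' hc hz f hf
    have hfix := h.fixes c' (fun x hx => (hc x (Or.inl hx)).trans (hold x hx)) hz f hf
    intro x hx
    by_cases hxS : x ∈ S
    · exact hfix x hxS
    have hvx : G.Adj v x := hx.resolve_left hxS
    have hvf : G.Adj v (f x) := by
      have := f.map_adj_iff.2 hvx
      rwa [hfix v hv] at this
    have hfS : f x ∉ S := fun hfS => hxS (by rwa [f.injective (hfix _ hfS)] at hfS)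
    refine hd _ hfS hvf x hxS hvx ?_
    rw [← hc _ (Or.inr hvf), ← hc x hx, hf x]

/-- If `G` is connected with girth at least 5, then `χ_D(G) ≤ Δ(G) + 2`. -/
theorem chiD_le_maxDegree_add_two_of_girth_ge_five {V : Type*} [Fintype V] [DecidableEq V]
    (G : SimpleGraph V) [DecidableRel G.Adj]
    (hconn : G.Connected) (hgirth : 5 ≤ G.girth) :
    ∃ φ : V → Fin (G.maxDegree + 2), IsProperDistinguishingColoring G φ := by
  obtain ⟨r⟩ := hconn.nonempty
  obtain ⟨S, ⟨c, hc⟩, hmax⟩ :=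
    (Set.toFinite {S : Set V | ∃ c : V → Fin (G.maxDegree + 2),
      IsFixingColoring G r 0 S c}).exists_maximal ⟨{r}, _, isFixingColoring_singleton G r 0⟩
  have hS : ∀ w ∉ S, ∀ a ∈ S, ∀ b ∈ S, G.Adj w a → G.Adj w b → a = b := by
    intro w hw a ha b hb hwa hwb
    by_contra hab
    exact hw (hmax (hc.exists_insert hgirth hw ha hb hab hwa hwb) (Set.subset_insert w S)
      (Set.mem_insert w S))
  have hclosed : ∀ v ∈ S, ∀ w, G.Adj v w → w ∈ S := fun v hv w hvw =>
    hmax (hc.exists_union_neighborSet hS hv) Set.subset_union_left (Or.inr hvw)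
  have hmem : ∀ x, x ∈ S := by
    intro x
    obtain ⟨p⟩ := hconn.preconnected r x
    have hwalk : ∀ {u w : V}, G.Walk u w → u ∈ S → w ∈ S := by
      intro u w q
      induction q with
      | nil => exact id
      | cons hadj _ ih => exact fun hu => ih (hclosed _ hu _ hadj)
    exact hwalk p hc.root_mem
  exact ⟨c, fun u v => hc.proper u (hmem u) v (hmem v), fun f hf v =>
    hc.fixes c (fun _ _ => rfl) (fun x => (hc.eq_root_iff x (hmem x)).1) f hf v (hmem v)⟩
end

section
/- If G is a connected finite simple graph with girth at least 5, then for every list assignment L that assigns to each vertex v a set L(v) of colors with |L(v)| ≥ Δ(G) + 2, there exists a proper distinguishing coloring φ of G with φ(v) ∈ L(v) for every vertex v. Equivalently, the distinguishing list chromatic number satisfies χ_D^ℓ(G) ≤ Δ(G) + 2. -/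
namespace SimpleGraph

variable {V : Type*} {G : SimpleGraph V}

lemma not_adj_of_common_neighbor_of_five_le_girth (hG : 5 ≤ G.girth) {p u v : V}
    (hu : G.Adj p u) (hv : G.Adj p v) : ¬ G.Adj u v := by
  intro huv
  let w : G.Walk p p := .cons hu (.cons huv (.cons hv.symm .nil))
  have hw : w.IsCycle := by
    simp [w, Walk.cons_isCycle_iff, hu.ne, hv.ne, huv.ne, hu.ne', hv.ne']
  have hlen : G.girth ≤ 3 := hw.girth_le_length
  omega

lemma eq_of_two_common_neighbors_of_five_le_girth (hG : 5 ≤ G.girth) {p q u v : V} (hpq : p ≠ q)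
    (hpu : G.Adj p u) (hpv : G.Adj p v) (hqu : G.Adj q u) (hqv : G.Adj q v) : u = v := by
  by_contra huv
  let w : G.Walk p p := .cons hpu (.cons hqu.symm (.cons hqv (.cons hpv.symm .nil)))
  have hw : w.IsCycle := by
    simp [w, Walk.cons_isCycle_iff, hpu.ne, hpv.ne, hqv.ne, hpu.ne', hpv.ne', hqu.ne',
      hpq, hpq.symm, huv]
  have hlen : G.girth ≤ 4 := hw.girth_le_length
  omega

lemma Connected.exists_adj_mem_notMem (hG : G.Connected) {S : Set V} {r v : V} (hr : r ∈ S)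
    (hv : v ∉ S) : ∃ p ∈ S, ∃ u ∉ S, G.Adj p u := by
  obtain ⟨w⟩ := hG.preconnected r v
  obtain ⟨d, -, hd, hd'⟩ := w.exists_boundary_dart S hr hv
  exact ⟨d.fst, hd, d.snd, hd', d.adj⟩

/-- The coloring `φ` from the lists `L` is proper on `S`, gives the color `c` within `S` to `r`
only, and every automorphism fixing `r` and preserving the colors within `S` fixes `S`
pointwise. -/
structure IsRootedColoringOn (G : SimpleGraph V) (L : V → Finset ℕ) (r : V) (c : ℕ)
    (S : Finset V) (φ : V → ℕ) : Prop where
  mem_list : ∀ v, φ v ∈ L v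
  root_mem : r ∈ S
  root_color : φ r = c
  ne_root_color : ∀ v ∈ S, v ≠ r → φ v ≠ c
  proper : ∀ u ∈ S, ∀ v ∈ S, G.Adj u v → φ u ≠ φ v
  fixes : ∀ f : G ≃g G, f r = r → (∀ v ∈ S, f v ∈ S → φ (f v) = φ v) → ∀ v ∈ S, f v = v

namespace IsRootedColoringOn

variable [DecidableEq V] {L : V → Finset ℕ} {r : V} {c : ℕ} {S : Finset V} {φ : V → ℕ}

/-- A rooted coloring on `S` extends along `ψ` to `S ∪ T` when `T` is independent. -/
lemma union (h : G.IsRootedColoringOn L r c S φ) {T : Finset V} {ψ : V → ℕ} (hST : Disjoint S T)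
    (hmem : ∀ v ∈ T, ψ v ∈ L v) (hc : ∀ v ∈ T, ψ v ≠ c)
    (hindep : ∀ u ∈ T, ∀ v ∈ T, ¬ G.Adj u v)
    (hproper : ∀ u ∈ S, ∀ v ∈ T, G.Adj u v → φ u ≠ ψ v)
    (hfix : ∀ f : G ≃g G, (∀ v ∈ S, f v = v) →
      (∀ v ∈ T, f v ∈ T → ψ (f v) = ψ v) → ∀ v ∈ T, f v = v) :
    G.IsRootedColoringOn L r c (S ∪ T) (fun v => if v ∈ T then ψ v else φ v) := by
  have hS : ∀ v ∈ S, v ∉ T := fun v hv => Finset.disjoint_left.1 hST hv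
  refine ⟨fun v => ?_, Finset.mem_union_left _ h.root_mem, ?_, fun v hv hvr => ?_,
    fun u hu v hv huv => ?_, fun f hr hf => ?_⟩
  · split_ifs with hv
    exacts [hmem v hv, h.mem_list v]
  · simpa [hS r h.root_mem] using h.root_color
  · by_cases hvT : v ∈ T
    · simpa [hvT] using hc v hvT
    · simpa [hvT] using h.ne_root_color v (by simpa [hvT] using hv) hvr
  · by_cases huT : u ∈ T <;> by_cases hvT : v ∈ T
    · exact absurd huv (hindep u huT v hvT)
    · simpa [huT, hvT] using (hproper v (by simpa [hvT] using hv) u huT huv.symm).symm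
    · simpa [huT, hvT] using hproper u (by simpa [huT] using hu) v hvT huv
    · simpa [huT, hvT] using
        h.proper u (by simpa [huT] using hu) v (by simpa [hvT] using hv) huv
  · have hfS : ∀ v ∈ S, f v = v := h.fixes f hr fun v hv hfv => by
      simpa [hS v hv, hS _ hfv] using
        hf v (Finset.mem_union_left _ hv) (Finset.mem_union_left _ hfv)
    have hfT : ∀ v ∈ T, f v = v := hfix f hfS fun v hv hfv => by
      simpa [hv, hfv] using hf v (Finset.mem_union_right _ hv) (Finset.mem_union_right _ hfv)
    intro v hv
    exact (Finset.mem_union.1 hv).elim (hfS v) (hfT v)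

variable [Fintype V] [DecidableRel G.Adj]

/-- A vertex with two neighbors in `S` can be added to `S`. -/
lemma exists_insert (hgirth : 5 ≤ G.girth) (hL : ∀ v, G.maxDegree + 2 ≤ (L v).card)
    (h : G.IsRootedColoringOn L r c S φ) {p q v : V} (hp : p ∈ S) (hq : q ∈ S) (hpq : p ≠ q)
    (hpv : G.Adj p v) (hqv : G.Adj q v) (hv : v ∉ S) :
    ∃ ψ, G.IsRootedColoringOn L r c (S ∪ {v}) ψ := by
  obtain ⟨a, haL, ha⟩ : ∃ a ∈ L v, a ∉ insert c ((G.neighborFinset v).image φ) := by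
    apply Finset.exists_mem_notMem_of_card_lt_card
    have h1 := Finset.card_insert_le c ((G.neighborFinset v).image φ)
    have h2 : ((G.neighborFinset v).image φ).card ≤ G.degree v := Finset.card_image_le
    have h3 := G.degree_le_maxDegree v
    have h4 := hL v
    omega
  simp only [Finset.mem_insert, Finset.mem_image, mem_neighborFinset, not_or, not_exists,
    not_and] at ha
  refine ⟨_, h.union (ψ := fun _ => a) (by simpa using hv) (by simpa using haL)
    (by simpa using ha.1) (by simp) ?_ ?_⟩
  · simp only [Finset.mem_singleton, forall_eq]
    exact fun u _ huv => ha.2 u huv.symm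
  · simp only [Finset.mem_singleton, forall_eq]
    intro f hf _
    refine eq_of_two_common_neighbors_of_five_le_girth hgirth hpq ?_ hpv ?_ hqv
    · simpa [hf p hp] using f.map_rel_iff.2 hpv
    · simpa [hf q hq] using f.map_rel_iff.2 hqv

/-- If no vertex outside `S` has two neighbors in `S`, then all neighbors of a vertex of `S` can
be added to `S`. -/
lemma exists_union_neighborFinset (hgirth : 5 ≤ G.girth)
    (hL : ∀ v, G.maxDegree + 2 ≤ (L v).card) (h : G.IsRootedColoringOn L r c S φ) {p : V}
    (hp : p ∈ S) (huniq : ∀ q ∈ S, ∀ v ∉ S, G.Adj p v → G.Adj q v → p = q) :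
    ∃ ψ, G.IsRootedColoringOn L r c (S ∪ (G.neighborFinset p \ S)) ψ := by
  set T := G.neighborFinset p \ S with hT
  have hmemT : ∀ {v}, v ∈ T ↔ G.Adj p v ∧ v ∉ S := by simp [hT]
  obtain ⟨g, hginj, hg⟩ := (Finset.all_card_le_biUnion_card_iff_exists_injective
    fun v : T => L v \ {c, φ p}).1 fun s => by
      obtain rfl | ⟨v, hv⟩ := s.eq_empty_or_nonempty
      · simp
      have h1 : s.card ≤ T.card := by simpa using s.card_le_univ
      have h2 : T.card ≤ G.degree p := Finset.card_le_card Finset.sdiff_subset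
      have h3 := G.degree_le_maxDegree p
      have h4 := Finset.le_card_sdiff {c, φ p} (L v)
      have h5 : ({c, φ p} : Finset ℕ).card ≤ 2 := Finset.card_le_two
      have h6 := hL v
      have h7 := Finset.card_le_card
        (Finset.subset_biUnion_of_mem (fun v : T => L v \ {c, φ p}) hv)
      omega
  simp only [Finset.mem_sdiff, Finset.mem_insert, Finset.mem_singleton, not_or] at hg
  have hψ : ∀ v (hv : v ∈ T), (fun v => if hv : v ∈ T then g ⟨v, hv⟩ else 0) v = g ⟨v, hv⟩ :=
    fun v hv => dif_pos hv
  generalize (fun v => if hv : v ∈ T then g ⟨v, hv⟩ else 0) = ψ at hψ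
  refine ⟨_, h.union (ψ := ψ) Finset.disjoint_sdiff (fun v hv => ?_) (fun v hv => ?_)
    (fun u hu v hv => ?_) (fun u hu v hv huv => ?_) (fun f hf hfψ v hv => ?_)⟩
  · exact hψ v hv ▸ (hg ⟨v, hv⟩).1
  · exact hψ v hv ▸ (hg ⟨v, hv⟩).2.1
  · exact not_adj_of_common_neighbor_of_five_le_girth hgirth (hmemT.1 hu).1 (hmemT.1 hv).1
  · obtain rfl := huniq u hu v (hmemT.1 hv).2 (hmemT.1 hv).1 huv
    exact hψ v hv ▸ Ne.symm (hg ⟨v, hv⟩).2.2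
  · have hfv : f v ∈ T := by
      refine hmemT.2 ⟨?_, fun hfv => (hmemT.1 hv).2 ?_⟩
      · simpa [hf p hp] using f.map_rel_iff.2 (hmemT.1 hv).1
      · rwa [f.injective (hf _ hfv)] at hfv
    have heq := hfψ v hv hfv
    rw [hψ _ hfv, hψ _ hv] at heq
    exact congrArg Subtype.val (hginj heq)

lemma exists_ssuperset (hconn : G.Connected) (hgirth : 5 ≤ G.girth)
    (hL : ∀ v, G.maxDegree + 2 ≤ (L v).card) (h : G.IsRootedColoringOn L r c S φ)
    (hS : S ≠ Finset.univ) : ∃ S' ψ, S ⊂ S' ∧ G.IsRootedColoringOn L r c S' ψ := by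
  obtain ⟨x, hx⟩ : ∃ x, x ∉ S := by simpa [Finset.eq_univ_iff_forall] using hS
  obtain ⟨p, hp, v, hv, hpv⟩ :=
    hconn.exists_adj_mem_notMem (S := (S : Set V)) h.root_mem (by simpa using hx)
  rw [Finset.mem_coe] at hp hv
  by_cases huniq : ∀ q ∈ S, ∀ v ∉ S, G.Adj p v → G.Adj q v → p = q
  · obtain ⟨ψ, hψ⟩ := h.exists_union_neighborFinset hgirth hL hp huniq
    refine ⟨_, ψ, (Finset.ssubset_iff_of_subset Finset.subset_union_left).2 ⟨v, ?_, hv⟩, hψ⟩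
    simp [hpv]
  · push Not at huniq
    obtain ⟨q, hq, u, hu, hpu, hqu, hpq⟩ := huniq
    obtain ⟨ψ, hψ⟩ := h.exists_insert hgirth hL hp hq hpq hpu hqu hu
    exact ⟨_, ψ, (Finset.ssubset_iff_of_subset Finset.subset_union_left).2
      ⟨u, by simp, hu⟩, hψ⟩

lemma exists_univ (hconn : G.Connected) (hgirth : 5 ≤ G.girth)
    (hL : ∀ v, G.maxDegree + 2 ≤ (L v).card) (h : G.IsRootedColoringOn L r c S φ) :
    ∃ ψ, G.IsRootedColoringOn L r c Finset.univ ψ := by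
  induction S using WellFoundedGT.induction generalizing φ with
  | ind S ih =>
    by_cases hS : S = Finset.univ
    · exact ⟨φ, hS ▸ h⟩
    · obtain ⟨S', ψ, hSS', hψ⟩ := h.exists_ssuperset hconn hgirth hL hS
      exact ih S' hSS' hψ

end IsRootedColoringOn

/-- Any coloring from the lists is a rooted coloring on the root. -/
lemma isRootedColoringOn_singleton {L : V → Finset ℕ} {φ : V → ℕ} (hφ : ∀ v, φ v ∈ L v)
    (r : V) : G.IsRootedColoringOn L r (φ r) {r} φ :=
  ⟨hφ, by simp, rfl, by simp, by simp, by simp +contextual⟩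

lemma IsRootedColoringOn.isProperDistinguishingColoring [Fintype V] {L : V → Finset ℕ} {r : V}
    {c : ℕ} {φ : V → ℕ} (h : G.IsRootedColoringOn L r c Finset.univ φ) :
    IsProperDistinguishingColoring G φ := by
  refine ⟨fun u v => h.proper u (Finset.mem_univ u) v (Finset.mem_univ v), fun f hf v => ?_⟩
  refine h.fixes f ?_ (fun v _ _ => hf v) v (Finset.mem_univ v)
  by_contra hr
  exact h.ne_root_color _ (Finset.mem_univ _) hr ((hf r).trans h.root_color)

end SimpleGraph

/-- If `G` is connected with girth at least 5, then its distinguishing list chromatic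
number is at most `Δ(G) + 2`: for any list assignment giving each vertex at least
`Δ(G) + 2` colors, there is a proper distinguishing coloring from the lists. -/
theorem chiD_list_le_maxDegree_add_two_of_girth_ge_five {V : Type*} [Fintype V] [DecidableEq V]
    (G : SimpleGraph V) [DecidableRel G.Adj]
    (hconn : G.Connected) (hgirth : 5 ≤ G.girth)
    (L : V → Finset ℕ) (hL : ∀ v, G.maxDegree + 2 ≤ (L v).card) :
    ∃ φ : V → ℕ, (∀ v, φ v ∈ L v) ∧ IsProperDistinguishingColoring G φ := by
  have hne : ∀ v, (L v).Nonempty := fun v => Finset.card_pos.1 (by have := hL v; omega)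
  choose φ hφ using hne
  obtain ⟨r⟩ := hconn.nonempty
  obtain ⟨ψ, hψ⟩ :=
    (SimpleGraph.isRootedColoringOn_singleton (G := G) hφ r).exists_univ hconn hgirth hL
  exact ⟨ψ, hψ.mem_list, hψ.isProperDistinguishingColoring⟩
end

section
/- If C_n is the cycle on n vertices with n ≥ 5 and n ≠ 6, then χ_D(C_n) ≤ 3. -/
theorem SimpleGraph.cycleGraph_adj_iff_val {n : ℕ} (hn : 2 ≤ n) (u v : Fin n) :
    (cycleGraph n).Adj u v ↔ u.val + 1 = v.val ∨ v.val + 1 = u.val ∨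
      (u.val = 0 ∧ v.val + 1 = n) ∨ (v.val = 0 ∧ u.val + 1 = n) := by
  have hu := u.isLt
  have hv := v.isLt
  rw [cycleGraph_adj']
  rcases lt_trichotomy u v with h | rfl | h
  · have h₁ := Fin.coe_sub_iff_lt.2 h
    have h₂ := Fin.coe_sub_iff_le.2 h.le
    rw [Fin.lt_def] at h
    omega
  · have h₁ := Fin.coe_sub_iff_le.2 (le_refl u)
    omega
  · have h₁ := Fin.coe_sub_iff_lt.2 h
    have h₂ := Fin.coe_sub_iff_le.2 h.le
    rw [Fin.lt_def] at h
    omega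

theorem SimpleGraph.cycleGraph_iso_eq_self {n : ℕ} (hn : 3 ≤ n)
    (f : cycleGraph n ≃g cycleGraph n) (h0 : (f ⟨0, by omega⟩).val = 0)
    (h1 : (f ⟨1, by omega⟩).val = 1) (v : Fin n) : f v = v := by
  have key : ∀ i, ∀ hi : i + 1 < n,
      (f ⟨i, by omega⟩).val = i ∧ (f ⟨i + 1, hi⟩).val = i + 1 := by
    intro i
    induction i with
    | zero => exact fun _ => ⟨h0, h1⟩
    | succ i ih =>
      intro hi
      obtain ⟨ha, hb⟩ := ih (by omega)
      refine ⟨hb, ?_⟩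
      have hadj : (cycleGraph n).Adj ⟨i + 1, by omega⟩ ⟨i + 1 + 1, hi⟩ := by
        rw [cycleGraph_adj_iff_val (by omega)]
        simp
      rw [← f.map_adj_iff, cycleGraph_adj_iff_val (by omega)] at hadj
      have hne : (f ⟨i + 1 + 1, hi⟩).val ≠ (f ⟨i, by omega⟩).val := by
        intro h
        have := f.injective (Fin.ext h)
        simp at this
        omega
      omega
  obtain ⟨i, hi⟩ := v
  ext
  cases i with
  | zero => exact h0
  | succ i => exact (key i hi).2

/-- The parity coloring of the cycle, except that vertex `0`, and for even `n` also vertex `3`,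
receives the third color. -/
def cycleColoring (n : ℕ) (v : Fin n) : Fin 3 :=
  if v.val = 0 ∨ (n % 2 = 0 ∧ v.val = 3) then 2 else if v.val % 2 = 0 then 0 else 1

theorem cycleColoring_eq_iff {n : ℕ} (u v : Fin n) :
    cycleColoring n u = cycleColoring n v ↔
      ((u.val = 0 ∨ (n % 2 = 0 ∧ u.val = 3)) ↔ (v.val = 0 ∨ (n % 2 = 0 ∧ v.val = 3))) ∧
      ((u.val = 0 ∨ (n % 2 = 0 ∧ u.val = 3)) ∨ u.val % 2 = v.val % 2) := by
  unfold cycleColoring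
  split_ifs <;> simp <;> omega

/-- For the cycle `C_n` with `n ≥ 5` and `n ≠ 6`, we have `χ_D(C_n) ≤ 3`. -/
theorem chiD_cycleGraph_le_three (n : ℕ) (hn : 5 ≤ n) (hn6 : n ≠ 6) :
    ∃ φ : Fin n → Fin 3, IsProperDistinguishingColoring (SimpleGraph.cycleGraph n) φ := by
  refine ⟨cycleColoring n, fun u v huv => ?_, fun f hf => ?_⟩
  · rw [SimpleGraph.cycleGraph_adj_iff_val (by omega)] at huv
    rw [Ne, cycleColoring_eq_iff]
    omega
  · have hadj (u v : Fin n) (h : u.val + 1 = v.val) :=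
      (SimpleGraph.cycleGraph_adj_iff_val (by omega) _ _).1
        (f.map_adj_iff.2 ((SimpleGraph.cycleGraph_adj_iff_val (by omega) u v).2 (Or.inl h)))
    have hcol (v : Fin n) := (cycleColoring_eq_iff _ _).1 (hf v)
    have c0 := hcol ⟨0, by omega⟩
    have c2 := hcol ⟨2, by omega⟩
    have c3 := hcol ⟨3, by omega⟩
    have a0 := hadj ⟨0, by omega⟩ ⟨1, by omega⟩ rfl
    have a1 := hadj ⟨1, by omega⟩ ⟨2, by omega⟩ rfl
    have a2 := hadj ⟨2, by omega⟩ ⟨3, by omega⟩ rfl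
    simp only [true_or, and_true, iff_true] at c0 c2 c3
    have h0 : (f ⟨0, by omega⟩).val = 0 := by omega
    have h1 : (f ⟨1, by omega⟩).val = 1 := by omega
    exact SimpleGraph.cycleGraph_iso_eq_self (by omega) f h0 h1
end

section
/- The 6-cycle C_6 has distinguishing chromatic number χ_D(C_6) = 4; in particular, C_6 has no proper distinguishing 3-coloring. -/
/-- The reflection `v ↦ a - v` of the 6-cycle. -/
def cycleGraphSixReflection (a : Fin 6) :
    SimpleGraph.cycleGraph 6 ≃g SimpleGraph.cycleGraph 6 where
  toEquiv := Equiv.subLeft a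
  map_rel_iff' := by
    intro u v
    revert a u v
    decide

/-- The rotation `v ↦ v + a` of the 6-cycle. -/
def cycleGraphSixRotation (a : Fin 6) :
    SimpleGraph.cycleGraph 6 ≃g SimpleGraph.cycleGraph 6 where
  toEquiv := Equiv.addRight a
  map_rel_iff' := by
    intro u v
    revert a u v
    decide

/-- Every proper 3-coloring of the 6-cycle is invariant under a reflection or under the
half-turn. -/
theorem reflection_or_halfTurn_invariant_of_proper (φ : Fin 6 → Fin 3)
    (h : ∀ v, φ v ≠ φ (v + 1)) :
    (∃ a, ∀ v, φ (a - v) = φ v) ∨ ∀ v, φ (v + 3) = φ v := by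
  revert φ
  decide +kernel

theorem IsProperDistinguishingColoring.comp_injective {V α β : Type*} {G : SimpleGraph V}
    {φ : V → α} (h : IsProperDistinguishingColoring G φ) {g : α → β}
    (hg : Function.Injective g) : IsProperDistinguishingColoring G (g ∘ φ) :=
  ⟨fun u v huv e => h.1 u v huv (hg e), fun f hf => h.2 f fun v => hg (hf v)⟩

theorem not_isProperDistinguishingColoring_cycleGraph_six (φ : Fin 6 → Fin 3) :
    ¬ IsProperDistinguishingColoring (SimpleGraph.cycleGraph 6) φ := by
  rintro ⟨hproper, hdist⟩
  have hadj : ∀ v : Fin 6, (SimpleGraph.cycleGraph 6).Adj v (v + 1) := by decide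
  rcases reflection_or_halfTurn_invariant_of_proper φ fun v => hproper _ _ (hadj v) with
    ⟨a, ha⟩ | hrot
  · have hfix : ∀ v : Fin 6, a - v = v := hdist (cycleGraphSixReflection a) ha
    clear ha
    revert a
    decide
  · have hfix : (0 : Fin 6) + 3 = 0 := hdist (cycleGraphSixRotation 3) hrot 0
    revert hfix
    decide

theorem isProperDistinguishingColoring_cycleGraph_six :
    IsProperDistinguishingColoring (SimpleGraph.cycleGraph 6)
      (![0, 1, 2, 3, 1, 2] : Fin 6 → Fin 4) := by
  refine ⟨by decide, fun f hf => ?_⟩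
  have h0 : f 0 = 0 := by
    have key : ∀ w : Fin 6, (![0, 1, 2, 3, 1, 2] : Fin 6 → Fin 4) w = 0 → w = 0 := by decide
    exact key _ (hf 0)
  have h3 : f 3 = 3 := by
    have key : ∀ w : Fin 6, (![0, 1, 2, 3, 1, 2] : Fin 6 → Fin 4) w = 3 → w = 3 := by decide
    exact key _ (hf 3)
  have key : ∀ v w : Fin 6,
      (![0, 1, 2, 3, 1, 2] : Fin 6 → Fin 4) w = (![0, 1, 2, 3, 1, 2] : Fin 6 → Fin 4) v →
      ((SimpleGraph.cycleGraph 6).Adj w 0 ↔ (SimpleGraph.cycleGraph 6).Adj v 0) →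
      ((SimpleGraph.cycleGraph 6).Adj w 3 ↔ (SimpleGraph.cycleGraph 6).Adj v 3) → w = v := by
    decide
  intro v
  refine key v (f v) (hf v) ?_ ?_
  · simpa only [h0] using f.map_adj_iff (v := v) (w := 0)
  · simpa only [h3] using f.map_adj_iff (v := v) (w := 3)

/-- The 6-cycle has distinguishing chromatic number exactly 4: it admits a proper
distinguishing 4-coloring, and any `k` admitting a proper distinguishing `k`-coloring
satisfies `4 ≤ k` (in particular there is no proper distinguishing 3-coloring). -/
theorem chiD_cycleGraph_six_eq_four :
    (∃ φ : Fin 6 → Fin 4, IsProperDistinguishingColoring (SimpleGraph.cycleGraph 6) φ) ∧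
    (∀ k : ℕ, (∃ φ : Fin 6 → Fin k,
        IsProperDistinguishingColoring (SimpleGraph.cycleGraph 6) φ) → 4 ≤ k) := by
  refine ⟨⟨_, isProperDistinguishingColoring_cycleGraph_six⟩, ?_⟩
  rintro k ⟨φ, hφ⟩
  by_contra! hk
  exact not_isProperDistinguishingColoring_cycleGraph_six _
    (hφ.comp_injective (Fin.castLE_injective (Nat.le_of_lt_succ hk)))
end

section
/- If G is a connected finite simple graph with girth at least 5 that is not regular (i.e., some vertex of G has degree strictly less than the maximum degree Δ(G)), then χ_D(G) ≤ Δ(G) + 1. -/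
namespace SimpleGraph

variable {V : Type*} {G : SimpleGraph V}

lemma not_adj_of_four_le_girth (hG : 4 ≤ G.girth) {a b c : V} (hab : G.Adj a b)
    (hbc : G.Adj b c) : ¬ G.Adj c a := by
  intro hca
  have hcyc : (Walk.cons hab (Walk.cons hbc (Walk.cons hca Walk.nil))).IsCycle := by
    rw [Walk.cons_isCycle_iff]
    simp [hab.ne, hbc.ne, hca.ne, hab.ne', hca.ne']
  have := hcyc.girth_le_length
  simp at this
  omega

lemma eq_of_adj_of_five_le_girth (hG : 5 ≤ G.girth) {p q a b : V} (hpq : p ≠ q)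
    (hpa : G.Adj p a) (hqa : G.Adj q a) (hpb : G.Adj p b) (hqb : G.Adj q b) : a = b := by
  by_contra hab
  have hcyc : (Walk.cons hpa (Walk.cons hqa.symm
      (Walk.cons hqb (Walk.cons hpb.symm Walk.nil)))).IsCycle := by
    rw [Walk.cons_isCycle_iff]
    simp [hpa.ne, hpb.ne, hqb.ne, hpa.ne', hqa.ne', hpb.ne', hpq, hpq.symm,
      hab]
  have := hcyc.girth_le_length
  simp at this
  omega

variable [Fintype V] [DecidableRel G.Adj]

variable (G) in
/-- A coloring `φ` of the vertices in `S` which is proper, uses color `0` on the root `r` and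
otherwise only on vertices of maximum degree, and such that every automorphism fixing `r` and
preserving colors within `S` fixes `S` pointwise. Moreover, every vertex of `S` other than
the root has a neighbor in `S`. -/
structure IsRigidPartialColoring (r : V) (S : Finset V) (φ : V → Fin (G.maxDegree + 1)) :
    Prop where
  root_mem : r ∈ S
  root_color : φ r = 0
  proper : ∀ u ∈ S, ∀ v ∈ S, G.Adj u v → φ u ≠ φ v
  zero : ∀ u ∈ S, φ u = 0 → u = r ∨ G.degree u = G.maxDegree
  rigid : ∀ f : G ≃g G, f r = r → (∀ u ∈ S, f u ∈ S → φ (f u) = φ u) → ∀ u ∈ S, f u = u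
  exists_adj : ∀ u ∈ S, u ≠ r → ∃ v ∈ S, G.Adj u v

namespace IsRigidPartialColoring

lemma singleton (r : V) : G.IsRigidPartialColoring r {r} (fun _ ↦ 0) where
  root_mem := by simp
  root_color := rfl
  proper := by simp
  zero := by simp
  rigid := by simp +contextual
  exists_adj := by simp +contextual

variable [DecidableEq V]

/-- There is a color which avoids those of the neighbors of `u` in `S` and is nonzero unless
`u` has maximum degree. -/
lemma exists_color (S : Finset V) (φ : V → Fin (G.maxDegree + 1)) (u : V) :
    ∃ c, (∀ v ∈ S, G.Adj u v → φ v ≠ c) ∧ (c = 0 → G.degree u = G.maxDegree) := by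
  set I := ((G.neighborFinset u).filter (· ∈ S)).image φ with hI
  have hIc : I.card ≤ G.degree u :=
    Finset.card_image_le.trans (Finset.card_filter_le _ _)
  have hmem : ∀ v ∈ S, G.Adj u v → φ v ∈ I := fun v hv h ↦
    Finset.mem_image_of_mem _ (by simp [hv, h])
  have hdeg := G.degree_le_maxDegree u
  by_cases h : ∃ c, c ∉ I ∧ c ≠ 0
  · obtain ⟨c, hc, hc0⟩ := h
    exact ⟨c, fun v hv hadj he ↦ hc (he ▸ hmem v hv hadj), fun h ↦ absurd h hc0⟩
  · push Not at h
    have hsub : Finset.univ.erase 0 ⊆ I := fun c hc ↦ by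
      by_contra hcI
      exact (Finset.ne_of_mem_erase hc) (h c hcI)
    have hcard := Finset.card_le_card hsub
    rw [Finset.card_erase_of_mem (Finset.mem_univ _), Finset.card_univ, Fintype.card_fin] at hcard
    have h0 : (0 : Fin (G.maxDegree + 1)) ∉ I := by
      intro h0
      have : I = Finset.univ := by
        ext c
        by_cases hc : c = 0
        · simp [hc, h0]
        · simp [hsub (Finset.mem_erase.2 ⟨hc, Finset.mem_univ _⟩)]
      rw [this, Finset.card_univ, Fintype.card_fin] at hIc
      omega
    exact ⟨0, fun v hv hadj he ↦ h0 (he ▸ hmem v hv hadj), fun _ ↦ by omega⟩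

variable {r : V} {S : Finset V} {φ : V → Fin (G.maxDegree + 1)}

/-- A vertex with two neighbors in `S` can be added to `S`. -/
lemma exists_insert (hG : 5 ≤ G.girth) (h : G.IsRigidPartialColoring r S φ) {u p q : V}
    (hu : u ∉ S) (hp : p ∈ S) (hq : q ∈ S) (hpq : p ≠ q) (hpu : G.Adj p u) (hqu : G.Adj q u) :
    ∃ ψ, G.IsRigidPartialColoring r (insert u S) ψ := by
  obtain ⟨c, hc, hc0⟩ := exists_color S φ u
  have hne : ∀ v ∈ S, v ≠ u := fun v hv e ↦ hu (e ▸ hv)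
  have hψ : ∀ v ∈ S, Function.update φ u c v = φ v := fun v hv ↦
    Function.update_of_ne (hne v hv) _ _
  refine ⟨Function.update φ u c, ?_, ?_, ?_, ?_, ?_, ?_⟩
  · exact Finset.mem_insert_of_mem h.root_mem
  · rw [hψ r h.root_mem, h.root_color]
  · intro a ha b hb hab
    rcases Finset.mem_insert.1 ha with rfl | haS <;> rcases Finset.mem_insert.1 hb with hbu | hbS
    · exact absurd hbu.symm hab.ne
    · rw [hψ b hbS, Function.update_self]
      exact (hc b hbS hab).symm
    · rw [hψ a haS, hbu, Function.update_self]
      exact hc a haS (hbu ▸ hab.symm)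
    · rw [hψ a haS, hψ b hbS]
      exact h.proper a haS b hbS hab
  · intro a ha ha0
    rcases Finset.mem_insert.1 ha with rfl | ha
    · rw [Function.update_self] at ha0
      exact Or.inr (hc0 ha0)
    · rw [hψ a ha] at ha0
      exact h.zero a ha ha0
  · intro f hfr hf
    have hS : ∀ a ∈ S, f a = a := h.rigid f hfr fun a ha hfa ↦ by
      have := hf a (Finset.mem_insert_of_mem ha) (Finset.mem_insert_of_mem hfa)
      rwa [hψ a ha, hψ _ hfa] at this
    intro a ha
    rcases Finset.mem_insert.1 ha with rfl | ha
    · have h1 := f.map_adj_iff.2 hpu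
      have h2 := f.map_adj_iff.2 hqu
      rw [hS p hp] at h1
      rw [hS q hq] at h2
      exact eq_of_adj_of_five_le_girth hG hpq h1 h2 hpu hqu
    · exact hS a ha
  · intro a ha har
    rcases Finset.mem_insert.1 ha with rfl | ha
    · exact ⟨p, Finset.mem_insert_of_mem hp, hpu.symm⟩
    · obtain ⟨v, hv, hav⟩ := h.exists_adj a ha har
      exact ⟨v, Finset.mem_insert_of_mem hv, hav⟩

/-- If no vertex outside `S` has two neighbors in `S`, then all neighbors of a vertex of `S`
can be added to `S`. -/
lemma exists_union_neighborFinset (hG : 4 ≤ G.girth) (hr : G.degree r < G.maxDegree)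
    (h : G.IsRigidPartialColoring r S φ) {p : V} (hp : p ∈ S)
    (huniq : ∀ u ∉ S, ∀ v ∈ S, G.Adj p u → G.Adj v u → v = p) :
    ∃ ψ, G.IsRigidPartialColoring r (S ∪ G.neighborFinset p) ψ := by
  set T := G.neighborFinset p \ S with hT
  have hTmem : ∀ u, u ∈ T ↔ G.Adj p u ∧ u ∉ S := by simp [hT]
  have hTcard : T.card + 1 ≤ G.maxDegree := by
    have hdeg := G.degree_le_maxDegree p
    by_cases hpr : p = r
    · have : T.card ≤ G.degree p := Finset.card_le_card Finset.sdiff_subset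
      rw [hpr] at this
      omega
    · obtain ⟨v, hv, hpv⟩ := h.exists_adj p hp hpr
      have : T.card < G.degree p := Finset.card_lt_card
        ⟨Finset.sdiff_subset, fun hs ↦ ((hTmem v).1 (hs (by simpa using hpv))).2 hv⟩
      omega
  set A : Finset (Fin (G.maxDegree + 1)) := (Finset.univ.erase 0).erase (φ p) with hA
  have hAcard : T.card ≤ A.card := by
    have h1 : (Finset.univ.erase (0 : Fin (G.maxDegree + 1))).card - 1 ≤ A.card := Finset.pred_card_le_card_erase
    rw [Finset.card_erase_of_mem (Finset.mem_univ _), Finset.card_univ, Fintype.card_fin] at h1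
    omega
  obtain ⟨g, hgA, hginj⟩ : ∃ g : V → Fin (G.maxDegree + 1), Set.MapsTo g T A ∧ Set.InjOn g T := by
    obtain ⟨g, hgA, hginj⟩ := T.finite_toSet.exists_injOn_of_encard_le
      (t := (A : Set (Fin (G.maxDegree + 1)))) (by simpa using hAcard)
    exact ⟨g, hgA, hginj⟩
  have hg0 : ∀ u ∈ T, g u ≠ 0 := fun u hu ↦ by
    have := hgA hu
    simp only [hA, Finset.coe_erase, Set.mem_sdiff, Set.mem_singleton_iff] at this
    tauto
  have hgp : ∀ u ∈ T, g u ≠ φ p := fun u hu ↦ by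
    have := hgA hu
    simp only [hA, Finset.coe_erase, Set.mem_sdiff, Set.mem_singleton_iff] at this
    tauto
  have hST : S ∪ G.neighborFinset p = S ∪ T := by simp [hT]
  rw [hST]
  set ψ : V → Fin (G.maxDegree + 1) := fun u ↦ if u ∈ S then φ u else g u with hψdef
  have hψS : ∀ v ∈ S, ψ v = φ v := fun v hv ↦ by simp [hψdef, hv]
  have hψT : ∀ v ∈ T, ψ v = g v := fun v hv ↦ by simp [hψdef, ((hTmem v).1 hv).2]
  have hSub {v} (hv : v ∈ S) : v ∈ S ∪ T := Finset.mem_union_left _ hv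
  have hcross : ∀ a ∈ S, ∀ b ∈ T, G.Adj a b → φ a ≠ g b := fun a ha b hb hab ↦ by
    have hb' := (hTmem b).1 hb
    rw [huniq b hb'.2 a ha hb'.1 hab]
    exact (hgp b hb).symm
  refine ⟨ψ, ?_, ?_, ?_, ?_, ?_, ?_⟩
  · exact hSub h.root_mem
  · rw [hψS r h.root_mem, h.root_color]
  · intro a ha b hb hab
    rcases Finset.mem_union.1 ha with ha | ha <;> rcases Finset.mem_union.1 hb with hb | hb
    · rw [hψS a ha, hψS b hb]
      exact h.proper a ha b hb hab
    · rw [hψS a ha, hψT b hb]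
      exact hcross a ha b hb hab
    · rw [hψT a ha, hψS b hb]
      exact (hcross b hb a ha hab.symm).symm
    · exact absurd ((hTmem b).1 hb).1.symm
        (not_adj_of_four_le_girth hG ((hTmem a).1 ha).1 hab)
  · intro a ha ha0
    rcases Finset.mem_union.1 ha with ha | ha
    · rw [hψS a ha] at ha0
      exact h.zero a ha ha0
    · rw [hψT a ha] at ha0
      exact absurd ha0 (hg0 a ha)
  · intro f hfr hf
    have hS : ∀ a ∈ S, f a = a := h.rigid f hfr fun a ha hfa ↦ by
      have := hf a (hSub ha) (hSub hfa)
      rwa [hψS a ha, hψS _ hfa] at this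
    intro a ha
    rcases Finset.mem_union.1 ha with ha | ha
    · exact hS a ha
    · have h1 := f.map_adj_iff.2 ((hTmem a).1 ha).1
      rw [hS p hp] at h1
      have h2 : f a ∈ T := (hTmem _).2
        ⟨h1, fun hfa ↦ ((hTmem a).1 ha).2 (f.injective (hS _ hfa) ▸ hfa)⟩
      have h3 := hf a (Finset.mem_union_right _ ha) (Finset.mem_union_right _ h2)
      rw [hψT _ h2, hψT a ha] at h3
      exact hginj h2 ha h3
  · intro a ha har
    rcases Finset.mem_union.1 ha with ha | ha
    · obtain ⟨v, hv, hav⟩ := h.exists_adj a ha har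
      exact ⟨v, hSub hv, hav⟩
    · exact ⟨p, hSub hp, ((hTmem a).1 ha).1.symm⟩

lemma exists_univ (hconn : G.Connected) (hG : 5 ≤ G.girth) (hr : G.degree r < G.maxDegree) :
    ∃ ψ, G.IsRigidPartialColoring r Finset.univ ψ := by
  obtain ⟨S, ⟨φ, h⟩, hmax⟩ := (Set.toFinite
    {S : Finset V | ∃ φ, G.IsRigidPartialColoring r S φ}).exists_maximal ⟨{r}, _, singleton r⟩
  suffices hS : S = Finset.univ from ⟨φ, hS ▸ h⟩
  by_contra hS
  obtain ⟨w, hw⟩ : ∃ w, w ∉ S := by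
    by_contra! hall
    exact hS (Finset.eq_univ_iff_forall.2 hall)
  obtain ⟨W⟩ := hconn.preconnected r w
  obtain ⟨d, -, hp, hu⟩ := W.exists_boundary_dart (S : Set V) h.root_mem hw
  by_cases huniq : ∀ u ∉ S, ∀ v ∈ S, G.Adj d.fst u → G.Adj v u → v = d.fst
  · have h' := exists_union_neighborFinset (by omega) hr h hp huniq
    exact hu (hmax h' Finset.subset_union_left (Finset.mem_union_right _ (by simp)))
  · push Not at huniq
    obtain ⟨u, hu, v, hv, hpu, hvu, hne⟩ := huniq
    have h' := exists_insert hG h hu hv hp hne hvu hpu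
    exact hu (hmax h' (Finset.subset_insert _ _) (Finset.mem_insert_self _ _))

end IsRigidPartialColoring

end SimpleGraph

/-- If `G` is connected with girth at least 5 and some vertex has degree strictly less
than the maximum degree, then `χ_D(G) ≤ Δ(G) + 1`. -/
theorem chiD_le_maxDegree_add_one_of_not_regular {V : Type*} [Fintype V] [DecidableEq V]
    (G : SimpleGraph V) [DecidableRel G.Adj]
    (hconn : G.Connected) (hgirth : 5 ≤ G.girth)
    (hnreg : ∃ v : V, G.degree v < G.maxDegree) :
    ∃ φ : V → Fin (G.maxDegree + 1), IsProperDistinguishingColoring G φ := by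
  obtain ⟨r, hr⟩ := hnreg
  obtain ⟨φ, h⟩ := SimpleGraph.IsRigidPartialColoring.exists_univ hconn hgirth hr
  refine ⟨φ, fun u v ↦ h.proper u (Finset.mem_univ _) v (Finset.mem_univ _), fun f hf v ↦ ?_⟩
  refine h.rigid f ?_ (fun u _ _ ↦ hf u) v (Finset.mem_univ _)
  refine (h.zero (f r) (Finset.mem_univ _) ((hf r).trans h.root_color)).resolve_right ?_
  rw [f.degree_eq]
  exact hr.ne
end

section
/- Let G be a connected finite simple graph with girth at least 5 and maximum degree Δ. If G contains vertices w, x, x_3 such that x and x_3 are adjacent, the distance from w to x is at least 3, and the distance from w to x_3 equals 3, then χ_D(G) ≤ Δ + 1. -/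
theorem SimpleGraph.not_adj_of_five_le_girth_s8 {V : Type*} {G : SimpleGraph V} (h : 5 ≤ G.girth)
    {a b c : V} (hab : G.Adj a b) (hbc : G.Adj b c) : ¬ G.Adj a c := by
  intro hac
  have hc : (SimpleGraph.Walk.cons hab (.cons hbc (.cons hac.symm .nil))).IsCycle := by
    have := hab.ne
    have := hbc.ne
    have := hac.ne
    rw [SimpleGraph.Walk.cons_isCycle_iff]
    simp
    grind
  have := SimpleGraph.girth_le_length hc
  simp at this
  omega

theorem SimpleGraph.eq_of_common_adj_of_five_le_girth_s8 {V : Type*} {G : SimpleGraph V}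
    (h : 5 ≤ G.girth) {a b p q : V} (hab : a ≠ b) (hap : G.Adj a p) (hbp : G.Adj b p)
    (haq : G.Adj a q) (hbq : G.Adj b q) : p = q := by
  by_contra hpq
  have hc : (SimpleGraph.Walk.cons hap
      (.cons hbp.symm (.cons hbq (.cons haq.symm .nil)))).IsCycle := by
    have := hap.ne
    have := hbp.ne
    have := haq.ne
    have := hbq.ne
    rw [SimpleGraph.Walk.cons_isCycle_iff]
    simp
    grind
  have := SimpleGraph.girth_le_length hc
  simp at this
  omega

theorem Finset.exists_injOn_mapsTo_of_card_le {α β : Type*} [Nonempty β] {s : Finset α}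
    {t : Finset β} (h : s.card ≤ t.card) :
    ∃ g : α → β, (∀ a ∈ s, g a ∈ t) ∧ ∀ a ∈ s, ∀ b ∈ s, g a = g b → a = b := by
  classical
  obtain ⟨e⟩ : Nonempty (s ↪ t) := Function.Embedding.nonempty_of_card_le (by simpa using h)
  refine ⟨fun a ↦ if ha : a ∈ s then e ⟨a, ha⟩ else Classical.arbitrary β, ?_, ?_⟩
  · intro a ha
    simp [ha]
  · intro a ha b hb hab
    simpa [ha, hb, ← Subtype.ext_iff] using hab

theorem Fin.exists_notMem_of_card_le {n : ℕ} (s : Finset (Fin (n + 1))) (h : s.card ≤ n) :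
    ∃ a, a ∉ s := by
  by_contra! hs
  have : s = Finset.univ := by ext; simp [hs]
  simp [this] at h

/-- `ψ` is proper on the edges inside `S`. -/
def ProperOn {V : Type*} {n : ℕ} (G : SimpleGraph V) (S : Finset V) (ψ : V → Fin (n + 1)) :
    Prop :=
  ∀ u ∈ S, ∀ v ∈ S, G.Adj u v → ψ u ≠ ψ v

theorem ProperOn.congr {V : Type*} {G : SimpleGraph V} {n : ℕ} {S : Finset V}
    {φ ψ : V → Fin (n + 1)} (h : ProperOn G S φ) (he : ∀ v ∈ S, ψ v = φ v) : ProperOn G S ψ := by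
  intro u hu v hv huv
  rw [he u hu, he v hv]
  exact h u hu v hv huv

theorem exists_ne_zero_not_adj_color {V : Type*} [Fintype V] {G : SimpleGraph V}
    [DecidableRel G.Adj] {n : ℕ} {w : V} {χ : V → Fin (n + 1)}
    (h : ((G.neighborFinset w).image χ).card < n) :
    ∃ a ≠ 0, ∀ u, G.Adj w u → χ u ≠ a := by
  obtain ⟨a, ha⟩ := Fin.exists_notMem_of_card_le (insert 0 ((G.neighborFinset w).image χ))
    ((Finset.card_insert_le _ _).trans h)
  simp only [Finset.mem_insert, Finset.mem_image, SimpleGraph.mem_neighborFinset, not_or,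
    not_exists, not_and] at ha
  exact ⟨a, ha.1, ha.2⟩

/-- If the color `0` is used outside `S` only next to all other colors, then a vertex of color `0`
missing another color in its neighborhood is mapped into `S`. -/
theorem apply_mem_of_missing_color {V : Type*} {G : SimpleGraph V} {n : ℕ} {S : Finset V}
    {w : V} {χ : V → Fin (n + 1)}
    (hχ : ∀ v ∉ S, χ v = 0 → ∀ a ≠ 0, ∃ u, G.Adj v u ∧ χ u = a) (hw : χ w = 0)
    (hmiss : ∃ a ≠ 0, ∀ u, G.Adj w u → χ u ≠ a) {f : G ≃g G} (hf : ∀ v, χ (f v) = χ v) :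
    f w ∈ S := by
  by_contra hS
  obtain ⟨a, ha, hwa⟩ := hmiss
  obtain ⟨u, hu, hua⟩ := hχ (f w) hS ((hf w).trans hw) a ha
  refine hwa (f.symm u) ?_ ?_
  · rw [← f.map_adj_iff]
    simpa using hu
  · rw [← hf]
    simpa using hua

section Extension

variable {V : Type*} [Fintype V] [DecidableEq V] {G : SimpleGraph V} [DecidableRel G.Adj] {n : ℕ}

/-- `ψ` is a suitable coloring of the neighbors of `p` outside `S`: they avoid the colors of their
neighbors in `S`, those whose only neighbor in `S` is `p` have distinct colors, and the color `0`
is only used next to all other colors. -/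
structure IsNeighborExtension (G : SimpleGraph V) (S : Finset V) (p : V)
    (ψ : V → Fin (n + 1)) : Prop where
  ne : ∀ c ∉ S, G.Adj p c → ∀ u ∈ S, G.Adj c u → ψ c ≠ ψ u
  inj : ∀ c ∉ S, ∀ d ∉ S, G.Adj p c → G.Adj p d → (∀ u ∈ S, G.Adj c u → u = p) →
    (∀ u ∈ S, G.Adj d u → u = p) → ψ c = ψ d → c = d
  zero : ∀ c ∉ S, G.Adj p c → ψ c = 0 → ∀ a ≠ 0, ∃ u ∈ S, G.Adj c u ∧ ψ u = a

theorem IsNeighborExtension.properOn (hg : 5 ≤ G.girth) {S : Finset V} {p : V}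
    {ψ : V → Fin (n + 1)} (h : IsNeighborExtension G S p ψ) (hS : ProperOn G S ψ) :
    ProperOn G (S ∪ G.neighborFinset p) ψ := by
  intro u hu v hv huv
  simp only [Finset.mem_union, SimpleGraph.mem_neighborFinset] at hu hv
  by_cases hu' : u ∈ S <;> by_cases hv' : v ∈ S
  · exact hS u hu' v hv' huv
  · exact (h.ne v hv' (hv.resolve_left hv') u hu' huv.symm).symm
  · exact h.ne u hu' (hu.resolve_left hu') v hv' huv
  · exact absurd (hv.resolve_left hv')
      (SimpleGraph.not_adj_of_five_le_girth_s8 hg (hu.resolve_left hu') huv)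

theorem IsNeighborExtension.fixes (hg : 5 ≤ G.girth) {S : Finset V} {p : V} (hp : p ∈ S)
    {ψ χ : V → Fin (n + 1)} (h : IsNeighborExtension G S p ψ)
    (hχ : ∀ v ∈ S ∪ G.neighborFinset p, χ v = ψ v) {f : G ≃g G} (hf : ∀ v, χ (f v) = χ v)
    (hfix : ∀ v ∈ S, f v = v) : ∀ v ∈ S ∪ G.neighborFinset p, f v = v := by
  intro v hv
  by_cases hvS : v ∈ S
  · exact hfix v hvS
  have hpv : G.Adj p v := by simpa [hvS] using hv
  have hpf : G.Adj p (f v) := by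
    have := f.map_adj_iff.mpr hpv
    rwa [hfix p hp] at this
  have hfS : f v ∉ S := fun hs ↦ hvS (by rwa [f.injective (hfix _ hs)] at hs)
  have hadj : ∀ u ∈ S, G.Adj (f v) u ↔ G.Adj v u := by
    intro u hu
    conv_lhs => rw [← hfix u hu]
    exact f.map_adj_iff
  by_contra hne
  have huniq : ∀ u ∈ S, G.Adj v u → u = p := by
    intro u hu huv
    exact SimpleGraph.eq_of_common_adj_of_five_le_girth_s8 hg hne
      ((hadj u hu).mpr huv) huv hpf.symm hpv.symm
  refine hne (h.inj (f v) hfS v hvS hpf hpv (fun u hu huv ↦ huniq u hu ((hadj u hu).mp huv))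
    huniq ?_)
  rw [← hχ _ (by simp [hpf]), ← hχ _ hv, hf]

theorem exists_isNeighborExtension (hdeg : ∀ v, G.degree v ≤ n) {S : Finset V} {p : V}
    (hp : ∃ q ∈ S, G.Adj p q) (φ : V → Fin (n + 1)) :
    ∃ ψ : V → Fin (n + 1), (∀ v ∈ S, ψ v = φ v) ∧ IsNeighborExtension G S p ψ := by
  obtain ⟨q, hq, hpq⟩ := hp
  let U : Finset V := {c ∈ G.neighborFinset p | c ∉ S ∧ ∀ u ∈ S, G.Adj c u → u = p}
  have hU : ∀ c, c ∈ U ↔ G.Adj p c ∧ c ∉ S ∧ ∀ u ∈ S, G.Adj c u → u = p := by simp [U]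
  have hUcard : U.card + 1 ≤ n := by
    have h1 : insert q U ⊆ G.neighborFinset p := by
      intro c hc
      rcases Finset.mem_insert.mp hc with rfl | hc
      · simpa using hpq
      · simpa using ((hU c).mp hc).1
    have h2 := Finset.card_le_card h1
    rw [Finset.card_insert_of_notMem (fun h ↦ ((hU q).mp h).2.1 hq)] at h2
    exact h2.trans (hdeg p)
  have hT : U.card ≤ (({0, φ p} : Finset (Fin (n + 1)))ᶜ).card := by
    rw [Finset.card_compl, Fintype.card_fin]
    have := Finset.card_le_two (a := (0 : Fin (n + 1))) (b := φ p)
    omega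
  obtain ⟨g, hgT, hgi⟩ := Finset.exists_injOn_mapsTo_of_card_le hT
  have hcol : ∀ c, ∃ a : Fin (n + 1), (∀ u ∈ S, G.Adj c u → a ≠ φ u) ∧
      (a = 0 → ∀ b ≠ 0, ∃ u ∈ S, G.Adj c u ∧ φ u = b) := by
    intro c
    by_cases h : ∃ a : Fin (n + 1), a ≠ 0 ∧ ∀ u ∈ S, G.Adj c u → a ≠ φ u
    · obtain ⟨a, ha, ha'⟩ := h
      exact ⟨a, ha', fun h ↦ absurd h ha⟩
    · push Not at h
      obtain ⟨a, ha⟩ := Fin.exists_notMem_of_card_le ((G.neighborFinset c).image φ)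
        (Finset.card_image_le.trans (hdeg c))
      refine ⟨a, fun u _ hu hau ↦ ha (Finset.mem_image.mpr ⟨u, by simpa using hu, hau.symm⟩),
        fun _ b hb ↦ ?_⟩
      obtain ⟨u, hu, hcu, hbu⟩ := h b hb
      exact ⟨u, hu, hcu, hbu.symm⟩
  choose r hr hr0 using hcol
  refine ⟨fun v ↦ if v ∈ S then φ v else if v ∈ U then g v else r v, by simp +contextual, ?_⟩
  constructor
  · intro c hc hpc u hu hcu
    by_cases hcU : c ∈ U
    · have := hgT c hcU
      have hup := ((hU c).mp hcU).2.2 u hu hcu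
      subst hup
      simp at this
      simp [hc, hu, hcU, this]
    · simpa [hc, hu, hcU] using hr c u hu hcu
  · intro c hc d hd hpc hpd hcu hdu hcd
    have hcU := (hU c).mpr ⟨hpc, hc, hcu⟩
    have hdU := (hU d).mpr ⟨hpd, hd, hdu⟩
    exact hgi c hcU d hdU (by simpa [hc, hd, hcU, hdU] using hcd)
  · intro c hc hpc h0 a ha
    by_cases hcU : c ∈ U
    · have := hgT c hcU
      simp [hc, hcU] at h0
      simp [h0] at this
    · simp [hc, hcU] at h0
      obtain ⟨u, hu, hcu, hua⟩ := hr0 c h0 a ha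
      exact ⟨u, hu, hcu, by simp [hu, hua]⟩

theorem IsNeighborExtension.exists_update (hdeg : ∀ v, G.degree v ≤ n) {S : Finset V} {p q x : V}
    (hp : p ∈ S) (hpS : ∃ u ∈ S, G.Adj p u) {ψ : V → Fin (n + 1)}
    (h : IsNeighborExtension G S p ψ) (h0 : ψ p = 0) (hq : q ∉ S) (hpq : G.Adj p q) (hx : x ∉ S)
    (hqx : G.Adj q x) :
    ∃ a, a ≠ ψ q ∧ IsNeighborExtension G S p (Function.update ψ q a) := by
  have key : ∃ a, a ≠ ψ q ∧ (∀ u ∈ S, G.Adj q u → a ≠ ψ u) ∧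
      ((∀ u ∈ S, G.Adj q u → u = p) → ∀ c ∉ S, G.Adj p c → (∀ u ∈ S, G.Adj c u → u = p) →
        a ≠ ψ c) := by
    by_cases hu : ∀ u ∈ S, G.Adj q u → u = p
    · obtain ⟨v, hv, hpv⟩ := hpS
      obtain ⟨a, ha⟩ := Fin.exists_notMem_of_card_le
        (insert 0 (((G.neighborFinset p).erase v).image ψ)) <| by
          have h1 := Finset.card_insert_le (0 : Fin (n + 1))
            (((G.neighborFinset p).erase v).image ψ)
          have h2 := Finset.card_image_le (s := (G.neighborFinset p).erase v) (f := ψ)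
          have h3 : ((G.neighborFinset p).erase v).card + 1 = G.degree p :=
            Finset.card_erase_add_one (by simpa using hpv)
          have := hdeg p
          omega
      simp only [Finset.mem_insert, Finset.mem_image, Finset.mem_erase,
        SimpleGraph.mem_neighborFinset, not_or, not_exists, not_and] at ha
      have hne : ∀ c ∉ S, G.Adj p c → a ≠ ψ c := fun c hc hpc hac ↦
        ha.2 c ⟨fun hcv ↦ hc (hcv ▸ hv), hpc⟩ hac.symm
      refine ⟨a, hne q hq hpq, fun w hw hqw ↦ ?_, fun _ c hc hpc _ ↦ hne c hc hpc⟩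
      rw [hu w hw hqw, h0]
      exact ha.1
    · obtain ⟨a, ha⟩ := Fin.exists_notMem_of_card_le
        (insert (ψ q) (((G.neighborFinset q).erase x).image ψ)) <| by
          have h1 := Finset.card_insert_le (ψ q) (((G.neighborFinset q).erase x).image ψ)
          have h2 := Finset.card_image_le (s := (G.neighborFinset q).erase x) (f := ψ)
          have h3 : ((G.neighborFinset q).erase x).card + 1 = G.degree q :=
            Finset.card_erase_add_one (by simpa using hqx)
          have := hdeg q
          omega
      simp only [Finset.mem_insert, Finset.mem_image, Finset.mem_erase,
        SimpleGraph.mem_neighborFinset, not_or, not_exists, not_and] at ha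
      exact ⟨a, ha.1, fun w hw hqw haw ↦ ha.2 w ⟨fun hwx ↦ hx (hwx ▸ hw), hqw⟩ haw.symm,
        fun h ↦ absurd h hu⟩
  obtain ⟨a, haq, ha, ha'⟩ := key
  have hS : ∀ u ∈ S, Function.update ψ q a u = ψ u := fun u hu ↦
    Function.update_of_ne (ne_of_mem_of_not_mem hu hq) _ _
  refine ⟨a, haq, ?_, ?_, ?_⟩
  · intro c hc hpc u hu hcu
    rw [hS u hu]
    by_cases hcq : c = q
    · subst hcq
      simpa using ha u hu hcu
    · simpa [hcq] using h.ne c hc hpc u hu hcu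
  · intro c hc d hd hpc hpd hcu hdu hcd
    by_cases hcq : c = q <;> by_cases hdq : d = q
    · rw [hcq, hdq]
    · subst hcq
      simp [hdq] at hcd
      exact absurd hcd (ha' hcu d hd hpd hdu)
    · subst hdq
      simp [hcq] at hcd
      exact absurd hcd.symm (ha' hdu c hc hpc hcu)
    · simp [hcq, hdq] at hcd
      exact h.inj c hc d hd hpc hpd hcu hdu hcd
  · intro c hc hpc hc0 b hb
    by_cases hcq : c = q
    · subst hcq
      simp at hc0
      exact absurd (hc0.trans h0.symm) (ha p hp hpq.symm)
    · simp [hcq] at hc0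
      obtain ⟨u, hu, hcu, hub⟩ := h.zero c hc hpc hc0 b hb
      exact ⟨u, hu, hcu, by rw [hS u hu, hub]⟩

/-- A proper coloring of `S` extends to a proper coloring of the whole graph for which an
automorphism fixing `S` pointwise is trivial and the color `0` is used outside `S` only next to
all other colors. -/
theorem exists_coloring_extension (hconn : G.Connected) (hg : 5 ≤ G.girth)
    (hdeg : ∀ v, G.degree v ≤ n) (S : Finset V) (hne : S.Nonempty)
    (hS : ∀ p ∈ S, ∃ q ∈ S, G.Adj p q) (φ : V → Fin (n + 1)) (hφ : ProperOn G S φ) :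
    ∃ χ : V → Fin (n + 1), (∀ v ∈ S, χ v = φ v) ∧ (∀ u v, G.Adj u v → χ u ≠ χ v) ∧
      (∀ v ∉ S, χ v = 0 → ∀ a ≠ 0, ∃ u, G.Adj v u ∧ χ u = a) ∧
      ∀ f : G ≃g G, (∀ v, χ (f v) = χ v) → (∀ v ∈ S, f v = v) → ∀ v, f v = v := by
  induction hk : Sᶜ.card using Nat.strong_induction_on generalizing S φ with
  | _ k ih =>
  by_cases huniv : ∀ v, v ∈ S
  · exact ⟨φ, fun _ _ ↦ rfl, fun u v ↦ hφ u (huniv u) v (huniv v),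
      fun v hv ↦ absurd (huniv v) hv, fun f _ hf v ↦ hf v (huniv v)⟩
  push Not at huniv
  obtain ⟨v, hv⟩ := huniv
  obtain ⟨u, hu⟩ := hne
  obtain ⟨W⟩ := hconn.preconnected u v
  obtain ⟨d, -, hd1, hd2⟩ := W.exists_boundary_dart (S : Set V) (by simpa using hu)
    (by simpa using hv)
  have hp : d.fst ∈ S := by simpa using hd1
  have hs : d.snd ∉ S := by simpa using hd2
  have hadj : G.Adj d.fst d.snd := d.adj
  generalize d.fst = p at *
  obtain ⟨ψ, hψφ, hψ⟩ := exists_isNeighborExtension hdeg (hS p hp) φ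
  have hlt : (S ∪ G.neighborFinset p)ᶜ.card < k := by
    rw [← hk]
    apply Finset.card_lt_card
    rw [Finset.compl_ssubset_compl]
    refine Finset.ssubset_iff_subset_ne.mpr ⟨Finset.subset_union_left, fun h ↦ hs ?_⟩
    rw [h]
    simp [hadj]
  obtain ⟨χ, h1, h2, h3, h4⟩ := ih _ hlt (S ∪ G.neighborFinset p) ⟨u, by simp [hu]⟩ (by
    intro q hq
    rcases Finset.mem_union.mp hq with hq | hq
    · obtain ⟨r, hr, hqr⟩ := hS q hq
      exact ⟨r, by simp [hr], hqr⟩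
    · exact ⟨p, by simp [hp], ((G.mem_neighborFinset p q).mp hq).symm⟩) ψ (hψ.properOn hg (hφ.congr hψφ)) rfl
  have hsub : ∀ v ∈ S, v ∈ S ∪ G.neighborFinset p := fun v hv ↦ by simp [hv]
  refine ⟨χ, fun v hv ↦ (h1 v (hsub v hv)).trans (hψφ v hv), h2, ?_, fun f hf hfS ↦
    h4 f hf (hψ.fixes hg hp h1 hf hfS)⟩
  intro v hv h0 a ha
  by_cases hpv : G.Adj p v
  · rw [h1 v (by simp [hpv])] at h0
    obtain ⟨u, hu, hvu, hua⟩ := hψ.zero v hv hpv h0 a ha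
    exact ⟨u, hvu, (h1 u (hsub u hu)).trans hua⟩
  · exact h3 v (by simp [hv, hpv]) h0 a ha

theorem exists_properDistinguishingColoring_of_degree_lt (hconn : G.Connected) (hg : 5 ≤ G.girth)
    (hdeg : ∀ v, G.degree v ≤ n) {w y : V} (hwy : G.Adj w y) (hw : G.degree w < n) :
    ∃ φ : V → Fin (n + 1), IsProperDistinguishingColoring G φ := by
  obtain ⟨g, hgT, hgi⟩ := Finset.exists_injOn_mapsTo_of_card_le
    (s := G.neighborFinset w) (t := ({0} : Finset (Fin (n + 1)))ᶜ)
    (by rw [Finset.card_compl, Fintype.card_fin, Finset.card_singleton]; exact hw.le)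
  simp only [SimpleGraph.mem_neighborFinset, Finset.mem_compl, Finset.mem_singleton] at hgT hgi
  obtain ⟨χ, h1, h2, h3, h4⟩ := exists_coloring_extension hconn hg hdeg
    (insert w (G.neighborFinset w)) ⟨w, by simp⟩ (by
      intro p hp
      rcases Finset.mem_insert.mp hp with rfl | hp
      · exact ⟨y, by simp [hwy], hwy⟩
      · exact ⟨w, by simp, ((G.mem_neighborFinset w p).mp hp).symm⟩)
    (fun v ↦ if v = w then 0 else g v) (by
      intro u hu v hv huv
      simp only [Finset.mem_insert, SimpleGraph.mem_neighborFinset] at hu hv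
      rcases hu with rfl | hu <;> rcases hv with rfl | hv
      · exact absurd huv (G.irrefl)
      · simpa [hv.ne'] using Ne.symm (hgT v hv)
      · simpa [hu.ne'] using hgT u hu
      · exact absurd hv (SimpleGraph.not_adj_of_five_le_girth_s8 hg hu huv))
  have hχw : χ w = 0 := by simp [h1]
  have hχN : ∀ u, G.Adj w u → χ u = g u := fun u hu ↦ by simp [h1, hu, hu.ne']
  refine ⟨χ, h2, fun f hf ↦ h4 f hf ?_⟩
  have hfw : f w = w := by
    have := apply_mem_of_missing_color h3 hχw
      (exists_ne_zero_not_adj_color (Finset.card_image_le.trans_lt hw)) hf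
    rcases Finset.mem_insert.mp this with h | h
    · exact h
    · rw [SimpleGraph.mem_neighborFinset] at h
      have h0 := hf w
      rw [hχw, hχN _ h] at h0
      exact absurd h0 (hgT _ h)
  intro v hv
  rcases Finset.mem_insert.mp hv with rfl | hv
  · exact hfw
  · rw [SimpleGraph.mem_neighborFinset] at hv
    have hfv : G.Adj w (f v) := by
      have := f.map_adj_iff.mpr hv
      rwa [hfw] at this
    refine hgi _ hfv _ hv ?_
    rw [← hχN _ hfv, ← hχN _ hv, hf]

theorem exists_properDistinguishingColoring_of_path (hconn : G.Connected) (hg : 5 ≤ G.girth)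
    (hdeg : ∀ v, G.degree v ≤ n) {w y x₁ x₂ x₃ x : V} (hwy : G.Adj w y) (hw1 : G.Adj w x₁)
    (hy1 : y ≠ x₁) (h12 : G.Adj x₁ x₂) (h23 : G.Adj x₂ x₃) (h3x : G.Adj x₃ x)
    (hd3 : 3 ≤ G.dist w x₃) (hdx : 3 ≤ G.dist w x) :
    ∃ φ : V → Fin (n + 1), IsProperDistinguishingColoring G φ := by
  have tri {a b c : V} := SimpleGraph.not_adj_of_five_le_girth_s8 hg (a := a) (b := b) (c := c)
  have sq {a b p q : V} :=
    SimpleGraph.eq_of_common_adj_of_five_le_girth_s8 hg (a := a) (b := b) (p := p) (q := q)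
  have hfar : ∀ v, 3 ≤ G.dist w v → v ≠ w ∧ ¬ G.Adj w v ∧ ∀ u, G.Adj w u → ¬ G.Adj u v := by
    intro v hv
    refine ⟨?_, fun h ↦ ?_, fun u hwu huv ↦ ?_⟩
    · rintro rfl
      simp at hv
    · have := SimpleGraph.dist_le (.cons h .nil)
      simp at this
      omega
    · have := SimpleGraph.dist_le (.cons hwu (.cons huv .nil))
      simp at this
      omega
  obtain ⟨h3w, hw3, hN3⟩ := hfar x₃ hd3
  obtain ⟨hxw, hwx, hNx⟩ := hfar x hdx
  have h2w : x₂ ≠ w := by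
    rintro rfl
    exact hw3 h23
  have hw2 : ¬ G.Adj w x₂ := fun h ↦ hN3 x₂ h h23
  have hy2 : ¬ G.Adj y x₂ := fun h ↦ hy1 (sq h2w.symm hwy h.symm hw1 h12.symm)
  have hn : 2 ≤ n := by
    refine le_trans ?_ (hdeg w)
    rw [← SimpleGraph.card_neighborFinset_eq_degree, ← Finset.card_pair hy1]
    exact Finset.card_le_card (by simp [Finset.insert_subset_iff, hwy, hw1])
  -- The star around `w`, with `y` and `x₁` of the same color.
  obtain ⟨g, hgT, hgi⟩ := Finset.exists_injOn_mapsTo_of_card_le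
    (s := (G.neighborFinset w).erase y) (t := ({0} : Finset (Fin (n + 1)))ᶜ) (by
      rw [Finset.card_compl, Fintype.card_fin, Finset.card_singleton]
      exact Finset.card_erase_le.trans (hdeg w))
  simp only [Finset.mem_erase, SimpleGraph.mem_neighborFinset, Finset.mem_compl,
    Finset.mem_singleton] at hgT hgi
  obtain ⟨S₁, hS₁⟩ : ∃ S, S = insert w (G.neighborFinset w) := ⟨_, rfl⟩
  have mem₁ : ∀ v, v ∈ S₁ ↔ v = w ∨ G.Adj w v := by simp [hS₁]
  obtain ⟨φ, hφw, hφy, hφg⟩ : ∃ φ : V → Fin (n + 1), φ w = 0 ∧ φ y = g x₁ ∧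
      ∀ v, G.Adj w v → v ≠ y → φ v = g v :=
    ⟨fun v ↦ if v = w then 0 else if v = y then g x₁ else g v, by simp, by simp [hwy.ne'],
      fun v hv hvy ↦ by simp [hv.ne', hvy]⟩
  have hφ0 : ∀ v, G.Adj w v → φ v ≠ 0 := by
    intro v hv
    by_cases hvy : v = y
    · rw [hvy, hφy]
      exact hgT x₁ ⟨hy1.symm, hw1⟩
    · rw [hφg v hv hvy]
      exact hgT v ⟨hvy, hv⟩
  have hφ : ProperOn G S₁ φ := by
    intro u hu v hv huv
    rcases (mem₁ u).mp hu with rfl | hu <;> rcases (mem₁ v).mp hv with rfl | hv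
    · exact absurd huv (G.irrefl)
    · rw [hφw]
      exact (hφ0 v hv).symm
    · rw [hφw]
      exact hφ0 u hu
    · exact absurd hv (tri hu huv)
  -- The neighbors of `y`.
  have hyS₁ : y ∈ S₁ := (mem₁ y).mpr (.inr hwy)
  have hwS₁ : w ∈ S₁ := (mem₁ w).mpr (.inl rfl)
  obtain ⟨ψ₂, e₂, ext₂⟩ := exists_isNeighborExtension hdeg ⟨w, hwS₁, hwy.symm⟩ φ
  have hψ₂0 : ∀ c ∉ S₁, G.Adj y c → ψ₂ c ≠ 0 := by
    intro c hc hyc h0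
    have hcw : w ≠ c := fun h ↦ hc (h ▸ hwS₁)
    obtain ⟨a, ha⟩ := Fin.exists_notMem_of_card_le {0, ψ₂ y} (Finset.card_le_two.trans hn)
    simp only [Finset.mem_insert, Finset.mem_singleton, not_or] at ha
    obtain ⟨u, hu, hcu, hua⟩ := ext₂.zero c hc hyc h0 a ha.1
    rcases (mem₁ u).mp hu with rfl | hu
    · exact hc ((mem₁ c).mpr (.inr hcu.symm))
    · exact ha.2 (by rw [← hua, sq hcw hu hcu hwy hyc.symm])
  obtain ⟨S₂, hS₂⟩ : ∃ S, S = S₁ ∪ G.neighborFinset y := ⟨_, rfl⟩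
  have mem₂ : ∀ v, v ∈ S₂ ↔ v ∈ S₁ ∨ G.Adj y v := by simp [hS₂]
  have prop₂ : ProperOn G S₂ ψ₂ := hS₂ ▸ ext₂.properOn hg (hφ.congr e₂)
  have hψ₂zero : ∀ v ∈ S₂, ψ₂ v = 0 → v = w := by
    intro v hv h0
    by_cases hv1 : v ∈ S₁
    · rcases (mem₁ v).mp hv1 with h | h
      · exact h
      · rw [e₂ v hv1] at h0
        exact absurd h0 (hφ0 v h)
    · exact absurd h0 (hψ₂0 v hv1 (((mem₂ v).mp hv).resolve_left hv1))
  -- The vertex `x₂` gets color `0`.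
  have hx₂ : x₂ ∉ S₂ := by simp [mem₂, mem₁, h2w, hw2, hy2]
  obtain ⟨S₃, hS₃⟩ : ∃ S, S = insert x₂ S₂ := ⟨_, rfl⟩
  have mem₃ : ∀ v, v ∈ S₃ ↔ v = x₂ ∨ v ∈ S₂ := by simp [hS₃]
  obtain ⟨ψ₃, hψ₃x, e₃⟩ : ∃ ψ₃ : V → Fin (n + 1), ψ₃ x₂ = 0 ∧ ∀ v ∈ S₂, ψ₃ v = ψ₂ v :=
    ⟨Function.update ψ₂ x₂ 0, by simp,
      fun v hv ↦ Function.update_of_ne (ne_of_mem_of_not_mem hv hx₂) _ _⟩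
  have hx₂0 : ∀ v ∈ S₂, G.Adj x₂ v → ψ₃ v ≠ 0 := by
    intro v hv hxv h0
    rw [e₃ v hv] at h0
    rw [hψ₂zero v hv h0] at hxv
    exact hw2 hxv.symm
  have prop₃ : ProperOn G S₃ ψ₃ := by
    intro u hu v hv huv
    rcases (mem₃ u).mp hu with rfl | hu <;> rcases (mem₃ v).mp hv with rfl | hv
    · exact absurd huv (G.irrefl)
    · rw [hψ₃x]
      exact (hx₂0 v hv huv).symm
    · rw [hψ₃x]
      exact hx₂0 u hu huv.symm
    · exact prop₂.congr e₃ u hu v hv huv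
  have hψ₃zero : ∀ v ∈ S₃, ψ₃ v = 0 → v = w ∨ v = x₂ := by
    intro v hv h0
    rcases (mem₃ v).mp hv with h | h
    · exact .inr h
    · exact .inl (hψ₂zero v h (e₃ v h ▸ h0))
  have sub₂ : ∀ v ∈ S₁, v ∈ S₂ := fun v hv ↦ (mem₂ v).mpr (.inl hv)
  have sub₃ : ∀ v ∈ S₂, v ∈ S₃ := fun v hv ↦ (mem₃ v).mpr (.inr hv)
  have hwS₃ : w ∈ S₃ := sub₃ w (sub₂ w hwS₁)
  have hx₂S₃ : x₂ ∈ S₃ := (mem₃ x₂).mpr (.inl rfl)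
  have hx₁S₁ : x₁ ∈ S₁ := (mem₁ x₁).mpr (.inr hw1)
  have hx₁S₃ : x₁ ∈ S₃ := sub₃ x₁ (sub₂ x₁ hx₁S₁)
  -- The other neighbors of `x₁`.
  obtain ⟨ψ₄, e₄, ext₄⟩ := exists_isNeighborExtension hdeg ⟨w, hwS₃, hw1.symm⟩ ψ₃
  have hψ₄0 : ∀ c ∉ S₃, G.Adj x₁ c → ψ₄ c ≠ 0 := by
    intro c hc h1c h0
    have hcw : w ≠ c := fun h ↦ hc (h ▸ hwS₃)
    have hc2 : x₂ ≠ c := fun h ↦ hc (h ▸ hx₂S₃)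
    have hcy : y ≠ c := fun h ↦ hc (h ▸ sub₃ y (sub₂ y hyS₁))
    have hn3 : 3 ≤ n := by
      refine le_trans ?_ (hdeg x₁)
      rw [← SimpleGraph.card_neighborFinset_eq_degree,
        ← Finset.card_eq_three.mpr ⟨w, x₂, c, h2w.symm, hcw, hc2, rfl⟩]
      exact Finset.card_le_card (by simp [Finset.insert_subset_iff, hw1.symm, h12, h1c])
    have key : ∀ u ∈ S₃, G.Adj c u → ψ₄ u ≠ 0 → ψ₄ u ≠ ψ₄ x₁ → G.Adj y u := by
      intro u hu hcu hu0 hu1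
      rcases (mem₃ u).mp hu with rfl | hu'
      · exact absurd h1c (tri h12 hcu.symm)
      rcases (mem₂ u).mp hu' with hu' | hu'
      · rcases (mem₁ u).mp hu' with rfl | hu'
        · exact absurd h1c (tri hw1.symm hcu.symm)
        · exact absurd (by rw [sq hcw hu' hcu hw1 h1c.symm]) hu1
      · exact hu'
    obtain ⟨a, ha⟩ := Fin.exists_notMem_of_card_le {0, ψ₄ x₁} (Finset.card_le_two.trans hn)
    simp only [Finset.mem_insert, Finset.mem_singleton, not_or] at ha
    obtain ⟨b, hb⟩ := Fin.exists_notMem_of_card_le {0, ψ₄ x₁, a} (Finset.card_le_three.trans hn3)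
    simp only [Finset.mem_insert, Finset.mem_singleton, not_or] at hb
    obtain ⟨u, hu, hcu, rfl⟩ := ext₄.zero c hc h1c h0 a ha.1
    obtain ⟨v, hv, hcv, rfl⟩ := ext₄.zero c hc h1c h0 b hb.1
    exact hb.2.2 (by rw [sq hcy (key u hu hcu ha.1 ha.2) hcu (key v hv hcv hb.1 hb.2.1) hcv])
  obtain ⟨S₄, hS₄⟩ : ∃ S, S = S₃ ∪ G.neighborFinset x₁ := ⟨_, rfl⟩
  have mem₄ : ∀ v, v ∈ S₄ ↔ v ∈ S₃ ∨ G.Adj x₁ v := by simp [hS₄]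
  have sub₄ : ∀ v ∈ S₃, v ∈ S₄ := fun v hv ↦ (mem₄ v).mpr (.inl hv)
  have prop₄ : ProperOn G S₄ ψ₄ := hS₄ ▸ ext₄.properOn hg (prop₃.congr e₄)
  have hψ₄zero : ∀ v ∈ S₄, ψ₄ v = 0 → v = w ∨ v = x₂ := by
    intro v hv h0
    by_cases hv3 : v ∈ S₃
    · exact hψ₃zero v hv3 (e₄ v hv3 ▸ h0)
    · exact absurd h0 (hψ₄0 v hv3 (((mem₄ v).mp hv).resolve_left hv3))
  -- The neighbors of `x₂`, with the color of `x₃` chosen so as to tell `x₂` from `w`.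
  have hx₃S₄ : x₃ ∉ S₄ := by
    simp [mem₄, mem₃, mem₂, mem₁, h3w, hw3, hN3 y hwy, hN3 x₁ hw1, h23.ne']
  have hxS₄ : x ∉ S₄ := by
    have : x ≠ x₂ := by
      rintro rfl
      exact hNx x₁ hw1 h12
    simp [mem₄, mem₃, mem₂, mem₁, hxw, hwx, hNx y hwy, hNx x₁ hw1, this]
  have hx₂S₄ : x₂ ∈ S₄ := sub₄ x₂ hx₂S₃
  have hx₂nbr : ∃ u ∈ S₄, G.Adj x₂ u := ⟨x₁, sub₄ x₁ hx₁S₃, h12.symm⟩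
  obtain ⟨ψ₅, b, e₅, ext₅, hcard⟩ : ∃ (ψ₅ : V → Fin (n + 1)) (b : Fin (n + 1)),
      (∀ v ∈ S₄, ψ₅ v = ψ₄ v) ∧ IsNeighborExtension G S₄ x₂ ψ₅ ∧
      ((G.neighborFinset x₂).filter (ψ₅ · = b)).card ≠
        ((G.neighborFinset w).filter (ψ₅ · = b)).card := by
    obtain ⟨ψ, e, hext⟩ := exists_isNeighborExtension hdeg hx₂nbr ψ₄
    by_cases hb : ((G.neighborFinset x₂).filter (ψ · = ψ x₃)).card =
        ((G.neighborFinset w).filter (ψ · = ψ x₃)).card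
    · obtain ⟨a, ha, hext'⟩ := hext.exists_update hdeg hx₂S₄ hx₂nbr
        (by rw [e x₂ hx₂S₄, e₄ x₂ hx₂S₃, hψ₃x]) hx₃S₄ h23 hxS₄ h3x
      refine ⟨Function.update ψ x₃ a, ψ x₃, fun v hv ↦ ?_, hext', ?_⟩
      · rw [Function.update_of_ne (ne_of_mem_of_not_mem hv hx₃S₄), e v hv]
      · have h1 : (G.neighborFinset w).filter (Function.update ψ x₃ a · = ψ x₃) =
            (G.neighborFinset w).filter (ψ · = ψ x₃) := by
          refine Finset.filter_congr fun v hv ↦ ?_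
          have : v ≠ x₃ := by
            rintro rfl
            exact hw3 (by simpa using hv)
          simp [this]
        have h2 : (G.neighborFinset x₂).filter (Function.update ψ x₃ a · = ψ x₃) =
            ((G.neighborFinset x₂).filter (ψ · = ψ x₃)).erase x₃ := by
          ext v
          by_cases hv : v = x₃
          · subst hv
            simp [ha]
          · simp [hv]
        have h3 : x₃ ∈ (G.neighborFinset x₂).filter (ψ · = ψ x₃) := by simp [h23]
        rw [h1, h2, ← hb]
        have := Finset.card_erase_add_one h3
        omega
    · exact ⟨ψ, ψ x₃, e, hext, hb⟩
  obtain ⟨S₅, hS₅⟩ : ∃ S, S = S₄ ∪ G.neighborFinset x₂ := ⟨_, rfl⟩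
  have mem₅ : ∀ v, v ∈ S₅ ↔ v ∈ S₄ ∨ G.Adj x₂ v := by simp [hS₅]
  have sub₅ : ∀ v ∈ S₄, v ∈ S₅ := fun v hv ↦ (mem₅ v).mpr (.inl hv)
  have prop₅ : ProperOn G S₅ ψ₅ := hS₅ ▸ ext₅.properOn hg (prop₄.congr e₅)
  have hψ₅x₂ : ψ₅ x₂ = 0 := by rw [e₅ x₂ hx₂S₄, e₄ x₂ hx₂S₃, hψ₃x]
  have hψ₅zero : ∀ v ∈ S₅, ψ₅ v = 0 → v = w ∨ v = x₂ := by
    intro v hv h0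
    by_cases hv4 : v ∈ S₄
    · exact hψ₄zero v hv4 (e₅ v hv4 ▸ h0)
    · have hv2 := ((mem₅ v).mp hv).resolve_left hv4
      exact absurd (h0.trans hψ₅x₂.symm) (ext₅.ne v hv4 hv2 x₂ hx₂S₄ hv2.symm)
  -- The coloring of the whole graph.
  have hnbr : ∀ p ∈ S₅, ∃ q ∈ S₅, G.Adj p q := by
    have m₅ {v : V} (h : v ∈ S₁) : v ∈ S₅ := sub₅ v (sub₄ v (sub₃ v (sub₂ v h)))
    intro p hp
    rcases (mem₅ p).mp hp with hp | hp
    · rcases (mem₄ p).mp hp with hp | hp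
      · rcases (mem₃ p).mp hp with rfl | hp
        · exact ⟨x₁, m₅ hx₁S₁, h12.symm⟩
        · rcases (mem₂ p).mp hp with hp | hp
          · rcases (mem₁ p).mp hp with rfl | hp
            · exact ⟨y, m₅ hyS₁, hwy⟩
            · exact ⟨w, m₅ hwS₁, hp.symm⟩
          · exact ⟨y, m₅ hyS₁, hp.symm⟩
      · exact ⟨x₁, m₅ hx₁S₁, hp.symm⟩
    · exact ⟨x₂, sub₅ x₂ hx₂S₄, hp.symm⟩
  obtain ⟨χ, c₅, hproper, hχ0, hrigid⟩ := exists_coloring_extension hconn hg hdeg S₅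
    ⟨x₂, sub₅ x₂ hx₂S₄⟩ hnbr ψ₅ prop₅
  have c₄ : ∀ v ∈ S₄, χ v = ψ₄ v := fun v hv ↦ (c₅ v (sub₅ v hv)).trans (e₅ v hv)
  have c₃ : ∀ v ∈ S₃, χ v = ψ₃ v := fun v hv ↦ (c₄ v (sub₄ v hv)).trans (e₄ v hv)
  have c₂ : ∀ v ∈ S₂, χ v = ψ₂ v := fun v hv ↦ (c₃ v (sub₃ v hv)).trans (e₃ v hv)
  have c₁ : ∀ v ∈ S₁, χ v = φ v := fun v hv ↦ (c₂ v (sub₂ v hv)).trans (e₂ v hv)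
  have hχg : ∀ v, G.Adj w v → v ≠ y → χ v = g v := fun v hv hvy ↦ by
    rw [c₁ v ((mem₁ v).mpr (.inr hv)), hφg v hv hvy]
  have hχy : χ y = g x₁ := by rw [c₁ y hyS₁, hφy]
  refine ⟨χ, hproper, fun f hf ↦ hrigid f hf ?_⟩
  have hadj {u v : V} (h : G.Adj u v) : G.Adj (f u) (f v) := f.map_adj_iff.mpr h
  have hmiss : ((G.neighborFinset w).image χ).card < n := by
    have hsub : (G.neighborFinset w).image χ ⊆ ((G.neighborFinset w).erase y).image χ := by
      intro a ha
      simp only [Finset.mem_image, SimpleGraph.mem_neighborFinset, Finset.mem_erase] at ha ⊢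
      obtain ⟨v, hv, rfl⟩ := ha
      by_cases hvy : v = y
      · exact ⟨x₁, ⟨hy1.symm, hw1⟩, by rw [hvy, hχy, hχg x₁ hw1 hy1.symm]⟩
      · exact ⟨v, ⟨hvy, hv⟩, rfl⟩
    refine (Finset.card_le_card hsub).trans_lt (Finset.card_image_le.trans_lt ?_)
    have := Finset.card_erase_add_one ((G.mem_neighborFinset w y).mpr hwy)
    rw [SimpleGraph.card_neighborFinset_eq_degree] at this
    have := hdeg w
    omega
  have hfw : f w = w := by
    have hw0 : χ w = 0 := by rw [c₁ w hwS₁, hφw]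
    have hmem := apply_mem_of_missing_color hχ0 hw0 (exists_ne_zero_not_adj_color hmiss) hf
    refine (hψ₅zero _ hmem (by rw [← c₅ _ hmem, hf, hw0])).resolve_right fun hfx ↦ hcard ?_
    symm
    have hval : ∀ v, G.Adj w v → (ψ₅ (f v) = b ↔ ψ₅ v = b) := by
      intro v hv
      rw [← c₅ (f v) ((mem₅ _).mpr (.inr (hfx ▸ hadj hv))), hf,
        c₅ v (sub₅ v (sub₄ v (sub₃ v (sub₂ v ((mem₁ v).mpr (.inr hv))))))]
    refine Finset.card_bij (fun v _ ↦ f v) ?_ (fun u _ v _ h ↦ f.injective h) ?_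
    · intro v hv
      simp only [Finset.mem_filter, SimpleGraph.mem_neighborFinset] at hv ⊢
      exact ⟨hfx ▸ hadj hv.1, (hval v hv.1).mpr hv.2⟩
    · intro v hv
      simp only [Finset.mem_filter, SimpleGraph.mem_neighborFinset] at hv ⊢
      obtain ⟨u, rfl⟩ := f.surjective v
      have hwu : G.Adj w u := f.map_adj_iff.mp (hfx ▸ hv.1)
      exact ⟨u, ⟨hwu, (hval u hwu).mp hv.2⟩, rfl⟩
  have hfN {v : V} (h : G.Adj w v) : G.Adj w (f v) := by
    have := hadj h
    rwa [hfw] at this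
  have hχ2 : χ x₂ = 0 := by rw [c₃ x₂ hx₂S₃, hψ₃x]
  have hfx₁ : f x₁ = x₁ := by
    by_cases hfy : f x₁ = y
    · have h : G.Adj y (f x₂) := hfy ▸ hadj h12
      have hmem : f x₂ ∈ S₂ := (mem₂ _).mpr (.inr h)
      have := hψ₂zero _ hmem (by rw [← c₂ _ hmem, hf, hχ2])
      exact absurd (f.injective (this.trans hfw.symm)) h2w
    · refine hgi _ ⟨hfy, hfN hw1⟩ _ ⟨hy1.symm, hw1⟩ ?_
      rw [← hχg _ (hfN hw1) hfy, ← hχg _ hw1 hy1.symm, hf]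
  have fix₁ : ∀ v ∈ S₁, f v = v := by
    have hne : ∀ v, G.Adj w v → v ≠ y → f v ≠ y → f v = v := by
      intro v hv hvy hfv
      refine hgi _ ⟨hfv, hfN hv⟩ _ ⟨hvy, hv⟩ ?_
      rw [← hχg _ (hfN hv) hfv, ← hχg _ hv hvy, hf]
    have hfy : f y = y := by
      by_contra h
      refine hy1 (f.injective (Eq.trans ?_ hfx₁.symm))
      refine hgi _ ⟨h, hfN hwy⟩ _ ⟨hy1.symm, hw1⟩ ?_
      rw [← hχg _ (hfN hwy) h, hf, hχy]
    intro v hv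
    rcases (mem₁ v).mp hv with rfl | hv
    · exact hfw
    · by_cases hvy : v = y
      · rw [hvy, hfy]
      · exact hne v hv hvy fun h ↦ hvy (f.injective (h.trans hfy.symm))
  have fix₂ : ∀ v ∈ S₂, f v = v := by
    subst hS₂
    exact ext₂.fixes hg hyS₁ c₂ hf fix₁
  have fix₃ : ∀ v ∈ S₃, f v = v := by
    intro v hv
    rcases (mem₃ v).mp hv with rfl | hv
    · have hmem : f v ∈ S₄ := (mem₄ _).mpr (.inr (by simpa only [hfx₁] using hadj h12))
      refine (hψ₄zero _ hmem (by rw [← c₄ _ hmem, hf, hχ2])).resolve_left fun h ↦ ?_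
      exact h2w (f.injective (h.trans hfw.symm))
    · exact fix₂ v hv
  have fix₄ : ∀ v ∈ S₄, f v = v := by
    subst hS₄
    exact ext₄.fixes hg hx₁S₃ c₄ hf fix₃
  subst hS₅
  exact ext₅.fixes hg hx₂S₄ c₅ hf fix₄

end Extension

/-- If `G` is connected with girth at least 5 and contains vertices `w`, `x`, `x₃` with
`x` adjacent to `x₃`, `dist(w,x) ≥ 3` and `dist(w,x₃) = 3`, then `χ_D(G) ≤ Δ(G) + 1`. -/
theorem chiD_le_maxDegree_add_one_of_far_edge {V : Type*} [Fintype V] [DecidableEq V]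
    (G : SimpleGraph V) [DecidableRel G.Adj]
    (hconn : G.Connected) (hgirth : 5 ≤ G.girth)
    (w x x₃ : V) (hadj : G.Adj x x₃)
    (hx : 3 ≤ G.dist w x) (hx₃ : G.dist w x₃ = 3) :
    ∃ φ : V → Fin (G.maxDegree + 1), IsProperDistinguishingColoring G φ := by
  have hdeg := G.degree_le_maxDegree
  obtain ⟨p, hp⟩ := hconn.exists_walk_length_eq_dist w x₃
  rw [hx₃] at hp
  obtain ⟨x₁, x₂, h1, h2, h3⟩ : ∃ x₁ x₂, G.Adj w x₁ ∧ G.Adj x₁ x₂ ∧ G.Adj x₂ x₃ := by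
    match p, hp with
    | .cons h1 (.cons h2 (.cons h3 .nil)), _ => exact ⟨_, _, h1, h2, h3⟩
  rcases (hdeg w).lt_or_eq with hw | hw
  · exact exists_properDistinguishingColoring_of_degree_lt hconn hgirth hdeg h1 hw
  have hwx₂ : w ≠ x₂ := by
    rintro rfl
    have := SimpleGraph.dist_le (.cons h3 .nil)
    simp [hx₃] at this
  have hcard : 1 < (G.neighborFinset w).card := by
    rw [SimpleGraph.card_neighborFinset_eq_degree, hw]
    refine lt_of_lt_of_le ?_ (hdeg x₁)
    rw [← SimpleGraph.card_neighborFinset_eq_degree, Finset.one_lt_card]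
    exact ⟨w, by simpa using h1.symm, x₂, by simpa using h2, hwx₂⟩
  obtain ⟨y, hy, hy1⟩ := Finset.exists_mem_ne hcard x₁
  exact exists_properDistinguishingColoring_of_path hconn hgirth hdeg
    ((G.mem_neighborFinset w y).mp hy) h1 hy1 h2 h3 hadj.symm hx₃.ge hx
end

section
/- Let G be a connected finite simple graph that is not bipartite, and suppose that for every vertex w and every pair of neighbors x_1, y_1 of w, some automorphism of G maps x_1 to y_1. Then G is vertex-transitive: for every pair of vertices x, y, some automorphism of G maps x to y. -/
/-- An equivalence relation that identifies any two neighbors of a common vertex identifies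
the endpoints of every walk of even length. -/
theorem SimpleGraph.Walk.setoid_rel_of_even_length {V : Type*} {G : SimpleGraph V} (r : Setoid V)
    (hr : ∀ w x y : V, G.Adj w x → G.Adj w y → r x y) {u v : V} :
    ∀ p : G.Walk u v, Even p.length → r u v
  | .nil, _ => r.refl _
  | .cons _ .nil, hp => by simp at hp
  | .cons h (.cons h' q), hp =>
    r.trans (hr _ _ _ h.symm h') (setoid_rel_of_even_length r hr q (by
      simpa [Nat.even_add_one] using hp))

/-- In a connected graph that is not bipartite, an equivalence relation that identifies any two
neighbors of a common vertex identifies all vertices. -/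
theorem SimpleGraph.Connected.setoid_rel_of_not_colorable_two {V : Type*} {G : SimpleGraph V}
    (hconn : G.Connected) (hbip : ¬ G.Colorable 2) (r : Setoid V)
    (hr : ∀ w x y : V, G.Adj w x → G.Adj w y → r x y) (x y : V) : r x y := by
  rw [SimpleGraph.two_colorable_iff_forall_loop_even] at hbip
  push Not at hbip
  obtain ⟨c, w, hw⟩ := hbip
  obtain ⟨p⟩ := hconn.preconnected x c
  obtain ⟨q⟩ := hconn.preconnected c y
  by_cases hpq : Even (p.append q).length
  · exact (p.append q).setoid_rel_of_even_length r hr hpq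
  · refine (p.append (w.append q)).setoid_rel_of_even_length r hr ?_
    simp only [SimpleGraph.Walk.length_append] at hpq ⊢
    grind

/-- The relation of lying in the same orbit of the automorphism group. -/
def SimpleGraph.automorphismSetoid {V : Type*} (G : SimpleGraph V) : Setoid V where
  r x y := ∃ f : G ≃g G, f x = y
  iseqv :=
    { refl := fun _ => ⟨.refl, rfl⟩
      symm := by
        rintro x _ ⟨f, rfl⟩
        exact ⟨f.symm, f.symm_apply_apply x⟩
      trans := by
        rintro x _ _ ⟨f, rfl⟩ ⟨g, rfl⟩
        exact ⟨f.trans g, rfl⟩ }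


/-- If `G` is a connected finite simple graph that is not bipartite (not 2-colorable) and
every two neighbors of a common vertex are related by an automorphism, then `G` is
vertex-transitive. -/
theorem vertexTransitive_of_neighbor_transitive {V : Type*} [Fintype V] (G : SimpleGraph V)
    (hconn : G.Connected) (hbip : ¬ G.Colorable 2)
    (h : ∀ w x y : V, G.Adj w x → G.Adj w y → ∃ f : G ≃g G, f x = y) :
    ∀ x y : V, ∃ f : G ≃g G, f x = y := by
  exact hconn.setoid_rel_of_not_colorable_two hbip G.automorphismSetoid h
end

section
/- If G is a connected finite simple graph that is Δ-regular, has girth at least 5, and has diameter at most 2, then G has exactly Δ² + 1 vertices. -/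
/-- The girth of a graph is at most `3` if it contains a triangle. -/
theorem SimpleGraph.girth_le_three_of_triangle {V : Type*} {G : SimpleGraph V} {a b c : V}
    (hab : G.Adj a b) (hbc : G.Adj b c) (hca : G.Adj c a) : G.girth ≤ 3 := by
  have hcyc : (Walk.cons hab (Walk.cons hbc (Walk.cons hca Walk.nil))).IsCycle := by
    simp [Walk.isCycle_def, Walk.isTrail_def, hab.ne, hbc.ne, hca.ne, hab.ne', hca.ne']
  exact girth_le_length hcyc

/-- The girth of a graph is at most `4` if two distinct vertices have two distinct common
neighbors. -/
theorem SimpleGraph.girth_le_four_of_common_neighbors {V : Type*} {G : SimpleGraph V}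
    {a b c d : V} (hab : G.Adj a b) (hbc : G.Adj b c) (hcd : G.Adj c d) (hda : G.Adj d a)
    (hac : a ≠ c) (hbd : b ≠ d) : G.girth ≤ 4 := by
  have hcyc : (Walk.cons hab (Walk.cons hbc (Walk.cons hcd (Walk.cons hda Walk.nil)))).IsCycle := by
    simp [Walk.isCycle_def, Walk.isTrail_def, hab.ne, hbc.ne, hcd.ne, hda.ne, hab.ne',
      hda.ne', hac, hac.symm, hbd]
  exact girth_le_length hcyc

/-- A connected `Δ`-regular graph with girth at least 5 and diameter at most 2 has exactly
`Δ² + 1` vertices. -/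
theorem card_eq_sq_add_one_of_regular_girth_five_diam_two {V : Type*} [Fintype V]
    [DecidableEq V] (G : SimpleGraph V) [DecidableRel G.Adj] (Δ : ℕ)
    (hconn : G.Connected) (hreg : G.IsRegularOfDegree Δ) (hgirth : 5 ≤ G.girth)
    (hdiam : ∀ u v : V, ∃ p : G.Walk u v, p.length ≤ 2) :
    Fintype.card V = Δ ^ 2 + 1 := by
  obtain ⟨v⟩ := hconn.nonempty
  have triangle_free {a b c : V} (hab : G.Adj a b) (hbc : G.Adj b c) (hca : G.Adj c a) : False := by
    have := SimpleGraph.girth_le_three_of_triangle hab hbc hca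
    omega
  have square_free {a b c d : V} (hab : G.Adj a b) (hbc : G.Adj b c) (hcd : G.Adj c d)
      (hda : G.Adj d a) (hac : a ≠ c) (hbd : b ≠ d) : False := by
    have := SimpleGraph.girth_le_four_of_common_neighbors hab hbc hcd hda hac hbd
    omega
  let branch (u : V) : Finset V := insert u ((G.neighborFinset u).erase v)
  have card_branch : ∀ u ∈ G.neighborFinset v, (branch u).card = Δ := by
    intro u hu
    rw [SimpleGraph.mem_neighborFinset] at hu
    have hvu : v ∈ G.neighborFinset u := by simpa using hu.symm
    rw [Finset.card_insert_of_notMem (by simp), Finset.card_erase_add_one hvu,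
      G.card_neighborFinset_eq_degree, hreg.degree_eq]
  have disjoint_branch : (G.neighborFinset v : Set V).PairwiseDisjoint branch := by
    intro a ha b hb hab
    simp only [Finset.mem_coe, SimpleGraph.mem_neighborFinset] at ha hb
    refine Finset.disjoint_left.mpr fun x hxa hxb => ?_
    simp only [branch, Finset.mem_insert, Finset.mem_erase, SimpleGraph.mem_neighborFinset]
      at hxa hxb
    rcases hxa with rfl | ⟨hxv, hax⟩ <;> rcases hxb with rfl | ⟨hxv', hbx⟩
    · exact hab rfl
    · exact triangle_free hb hbx ha.symm
    · exact triangle_free ha hax hb.symm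
    · exact square_free ha hax hbx.symm hb.symm hxv.symm hab
  have cover : Finset.univ.erase v = (G.neighborFinset v).biUnion branch := by
    ext x
    simp only [branch, Finset.mem_erase, Finset.mem_univ, and_true, Finset.mem_biUnion,
      Finset.mem_insert, SimpleGraph.mem_neighborFinset]
    constructor
    · intro hxv
      obtain ⟨p, hp⟩ := hdiam v x
      match p, hp with
      | .nil, _ => exact absurd rfl hxv
      | .cons h .nil, _ => exact ⟨x, h, .inl rfl⟩
      | .cons h (.cons h' .nil), _ => exact ⟨_, h, .inr ⟨hxv, h'⟩⟩
      | .cons _ (.cons _ (.cons _ _)), hp => simp at hp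
    · rintro ⟨u, hu, rfl | ⟨hxv, -⟩⟩
      · exact hu.ne'
      · exact hxv
  rw [← Finset.card_univ, ← Finset.card_erase_add_one (Finset.mem_univ v), cover,
    Finset.card_biUnion disjoint_branch, Finset.sum_congr rfl card_branch, Finset.sum_const,
    G.card_neighborFinset_eq_degree, hreg.degree_eq, smul_eq_mul, sq]
end
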